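/- arXiv:1403.3607 — 3 statements merged into one kernel-verified Lean document; each statement's English description precedes it below -/
import Mathlib

section
/- Let p > 3 be a prime, q = p^r, and let a ∈ F_q^×. Then (1/(q−1)) Σ_{l=0}^{q−2} G_{−l}³ G_{3l} T^{−3l}(−3a) = (q²·φ(−3a)/(q−1)) Σ_{l=0}^{q−2} [G_{−2l}³ G_{6l} / (G_{−l}³ G_{3l})] · T^{−3l}(−3a), as an identity of complex numbers (all Gauss sums G_k are nonzero in ℂ, so the quotients are well defined; indices of G and exponents of T are taken modulo q−1). -/
open Finset in
/-- The number of square roots of `v` is `1 + η v`, in summed form: `∑ f(u²) = ∑ (1 + η v) f(v)`. -/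
lemma sum_comp_sq_eq_sum_quadraticChar {F : Type*} [Field F] [Fintype F] [DecidableEq F]
    (hF : ringChar F ≠ 2) (f : F → ℂ) :
    ∑ u, f (u ^ 2) = ∑ v, (1 + (quadraticChar F v : ℂ)) * f v := by
  rw [← sum_fiberwise univ (fun u : F ↦ u ^ 2)]
  refine sum_congr rfl fun v _ ↦ ?_
  have hcard := quadraticChar_card_sqrts hF v
  have hset : {x : F | x ^ 2 = v}.toFinset = univ.filter (fun u : F ↦ u ^ 2 = v) := by
    ext; simp
  rw [hset] at hcard
  rw [sum_congr rfl (g := fun _ ↦ f v) (fun u hu ↦ by rw [(mem_filter.mp hu).2]), sum_const,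
    nsmul_eq_mul]
  congr 1
  rw [add_comm]
  exact_mod_cast hcard

/-- The quadratic character of a finite field, with complex values. -/
noncomputable def complexQuadraticChar (F : Type*) [Field F] [Fintype F] : MulChar F ℂ :=
  open Classical in (quadraticChar F).ringHomComp (Int.castRingHom ℂ)

section

variable {F : Type*} [Field F] [Fintype F]

lemma complexQuadraticChar_isQuadratic : (complexQuadraticChar F).IsQuadratic := by
  classical exact (quadraticChar_isQuadratic F).comp _

lemma complexQuadraticChar_ne_one (hF : ringChar F ≠ 2) : complexQuadraticChar F ≠ 1 := by
  classical
  exact (MulChar.ringHomComp_ne_one_iff (Int.cast_injective (α := ℂ))).mpr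
    (quadraticChar_ne_one hF)

lemma MulChar.eq_one_or_eq_complexQuadraticChar {χ : MulChar F ℂ} (hχ : χ ^ 2 = 1) :
    χ = 1 ∨ χ = complexQuadraticChar F := by
  classical
  have hsq (x : Fˣ) : χ x * χ x = 1 := by
    rw [← MulChar.mul_apply, ← pow_two, hχ, MulChar.one_apply_coe]
  have hsquare {x : F} (hx : x ≠ 0) (h : quadraticChar F x = 1) : χ x = 1 := by
    obtain ⟨y, rfl⟩ := (quadraticChar_one_iff_isSquare hx).mp h
    have hy : y ≠ 0 := by rintro rfl; simp at hx
    rw [map_mul]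
    exact hsq (Units.mk0 y hy)
  refine or_iff_not_imp_left.mpr fun hne ↦ ?_
  obtain ⟨u, hu⟩ := MulChar.ne_one_iff.mp hne
  have hqu : quadraticChar F u = -1 :=
    (quadraticChar_dichotomy u.ne_zero).resolve_left fun h ↦ hu (hsquare u.ne_zero h)
  have hχu : χ u = -1 := (mul_self_eq_one_iff.mp (hsq u)).resolve_left hu
  ext x
  change χ x = ((quadraticChar F x : ℤ) : ℂ)
  rcases quadraticChar_dichotomy x.ne_zero with h | h
  · rw [h, hsquare x.ne_zero h, Int.cast_one]
  · have h1 : χ (x * u) = 1 :=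
      hsquare (mul_ne_zero x.ne_zero u.ne_zero) (by rw [map_mul, h, hqu]; norm_num)
    rw [map_mul, hχu] at h1
    rw [h]
    push_cast
    linear_combination -h1

lemma jacobiSum_self_eq_jacobiSum_complexQuadraticChar (hF : ringChar F ≠ 2)
    {χ : MulChar F ℂ} (hχ : χ ≠ 1) :
    χ 4 * jacobiSum χ χ = jacobiSum χ (complexQuadraticChar F) := by
  classical
  have h2 : (2 : F) ≠ 0 := Ring.two_ne_zero hF
  let e : F ≃ F := (Equiv.subLeft 1).trans (Equiv.divRight₀ 2 h2)
  have hsum : ∑ v : F, χ (1 - v) = 0 :=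
    (Equiv.sum_comp (Equiv.subLeft 1) χ).trans (χ.sum_eq_zero_of_ne_one hχ)
  calc χ 4 * jacobiSum χ χ = ∑ u : F, χ (1 - u ^ 2) := by
        rw [jacobiSum, ← Equiv.sum_comp e, Finset.mul_sum]
        refine Finset.sum_congr rfl fun u _ ↦ ?_
        rw [← map_mul, ← map_mul]
        congr 1
        simp only [e, Equiv.trans_apply, Equiv.subLeft_apply, Equiv.divRight₀_apply]
        field_simp
        ring
    _ = ∑ v : F, (1 + (quadraticChar F v : ℂ)) * χ (1 - v) :=
        sum_comp_sq_eq_sum_quadraticChar hF fun v ↦ χ (1 - v)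
    _ = jacobiSum χ (complexQuadraticChar F) := by
        simp_rw [add_mul, one_mul]
        rw [Finset.sum_add_distrib, hsum, zero_add, jacobiSum_comm, jacobiSum]
        rfl

lemma gaussSum_ne_zero {ψ : AddChar F ℂ} (hψ : ψ ≠ 1) (χ : MulChar F ℂ) : gaussSum χ ψ ≠ 0 := by
  by_cases hχ : χ = 1
  · rw [hχ, gaussSum_one_left hψ]
    norm_num
  · exact gaussSum_ne_zero_of_nontrivial (Nat.cast_ne_zero.mpr Fintype.card_ne_zero) hχ
      (AddChar.IsPrimitive.of_ne_one hψ)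

/-- The Hasse-Davenport product formula for the quadratic character. -/
lemma gaussSum_mul_gaussSum_mul_complexQuadraticChar (hF : ringChar F ≠ 2)
    {ψ : AddChar F ℂ} (hψ : ψ ≠ 1) (χ : MulChar F ℂ) :
    χ 4 * gaussSum (χ * complexQuadraticChar F) ψ * gaussSum χ ψ =
      gaussSum (χ ^ 2) ψ * gaussSum (complexQuadraticChar F) ψ := by
  have h2 : (2 : F) ≠ 0 := Ring.two_ne_zero hF
  have hη := (complexQuadraticChar_isQuadratic (F := F)).sq_eq_one
  by_cases hχ : χ ^ 2 = 1
  · have h4 : χ 4 = 1 := by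
      rw [show (4 : F) = 2 * 2 by norm_num, map_mul, ← MulChar.mul_apply, ← pow_two, hχ,
        MulChar.one_apply h2.isUnit]
    rw [hχ, h4, one_mul]
    rcases MulChar.eq_one_or_eq_complexQuadraticChar hχ with rfl | rfl
    · rw [one_mul, mul_comm]
    · rw [← pow_two, hη]
  · have hχ1 : χ ≠ 1 := by rintro rfl; simp at hχ
    have hχη : χ * complexQuadraticChar F ≠ 1 := by
      intro h
      apply hχ
      rw [eq_inv_of_mul_eq_one_left h, inv_pow, hη, inv_one]
    have h1 := jacobiSum_mul_nontrivial (by rwa [← pow_two]) ψ (χ := χ) (φ := χ)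
    have h3 := jacobiSum_mul_nontrivial hχη ψ
    have h4 := jacobiSum_self_eq_jacobiSum_complexQuadraticChar hF hχ1
    rw [← pow_two] at h1
    rw [← h4] at h3
    apply mul_right_cancel₀ (gaussSum_ne_zero hψ χ)
    linear_combination (-χ 4 * gaussSum (χ * complexQuadraticChar F) ψ) * h1
      + gaussSum (χ ^ 2) ψ * h3

lemma gaussSum_complexQuadraticChar_pow_four (hF : ringChar F ≠ 2)
    {ψ : AddChar F ℂ} (hψ : ψ ≠ 1) :
    gaussSum (complexQuadraticChar F) ψ ^ 4 = (Fintype.card F : ℂ) ^ 2 := by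
  have h := gaussSum_sq (complexQuadraticChar_ne_one hF) complexQuadraticChar_isQuadratic
    (AddChar.IsPrimitive.of_ne_one hψ)
  have h1 : complexQuadraticChar F (-1) ^ 2 = 1 := by
    rw [← map_pow, neg_one_sq, map_one]
  rw [show 4 = 2 * 2 from rfl, pow_mul, h, mul_pow, h1, one_mul]

/-- Duplicating the characters in the summand amounts to twisting by the quadratic character. -/
lemma gaussSum_cube_ratio_eq (hF : ringChar F ≠ 2) {ψ : AddChar F ℂ} (hψ : ψ ≠ 1)
    (χ : MulChar F ℂ) :
    (Fintype.card F : ℂ) ^ 2 * (gaussSum (χ⁻¹ ^ 2) ψ ^ 3 * gaussSum ((χ ^ 3) ^ 2) ψ /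
        (gaussSum χ⁻¹ ψ ^ 3 * gaussSum (χ ^ 3) ψ)) =
      gaussSum (χ * complexQuadraticChar F)⁻¹ ψ ^ 3 *
        gaussSum ((χ * complexQuadraticChar F) ^ 3) ψ := by
  have hη := complexQuadraticChar_isQuadratic (F := F)
  have h4 : (4 : F) ≠ 0 := by
    rw [show (4 : F) = 2 * 2 by norm_num]
    exact mul_ne_zero (Ring.two_ne_zero hF) (Ring.two_ne_zero hF)
  have hχ4 : χ⁻¹ 4 * χ 4 = 1 := by
    rw [← MulChar.mul_apply, inv_mul_cancel, MulChar.one_apply h4.isUnit]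
  have hinv : (χ * complexQuadraticChar F)⁻¹ = χ⁻¹ * complexQuadraticChar F := by
    rw [mul_inv, hη.inv]
  have hcube : (χ * complexQuadraticChar F) ^ 3 = χ ^ 3 * complexQuadraticChar F := by
    rw [mul_pow, pow_succ (complexQuadraticChar F) 2, hη.sq_eq_one, one_mul]
  have h1 := gaussSum_mul_gaussSum_mul_complexQuadraticChar hF hψ χ⁻¹
  have h3 := gaussSum_mul_gaussSum_mul_complexQuadraticChar hF hψ (χ ^ 3)
  rw [MulChar.pow_apply' χ (by norm_num)] at h3
  rw [hinv, hcube, ← gaussSum_complexQuadraticChar_pow_four hF hψ, mul_div_assoc',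
    div_eq_iff (mul_ne_zero (pow_ne_zero _ (gaussSum_ne_zero hψ _)) (gaussSum_ne_zero hψ _))]
  calc _ = (gaussSum (χ⁻¹ ^ 2) ψ * gaussSum (complexQuadraticChar F) ψ) ^ 3 *
        (gaussSum ((χ ^ 3) ^ 2) ψ * gaussSum (complexQuadraticChar F) ψ) := by ring
    _ = (χ⁻¹ 4 * χ 4) ^ 3 * (gaussSum (χ⁻¹ * complexQuadraticChar F) ψ ^ 3 *
        gaussSum (χ ^ 3 * complexQuadraticChar F) ψ *
        (gaussSum χ⁻¹ ψ ^ 3 * gaussSum (χ ^ 3) ψ)) := by rw [← h1, ← h3]; ring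
    _ = _ := by rw [hχ4, one_pow, one_mul]

/-- A generator of the character group of a finite field has order `q - 1`. -/
lemma MulChar.orderOf_eq_card_sub_one {T : MulChar F ℂ}
    (hT : ∀ χ : MulChar F ℂ, χ ∈ Subgroup.zpowers T) : orderOf T = Fintype.card F - 1 := by
  classical
  rw [orderOf_eq_card_of_forall_mem_zpowers hT,
    MulChar.card_eq_card_units_of_hasEnoughRootsOfUnity, Nat.card_eq_fintype_card,
    Fintype.card_units]

end

lemma sum_range_orderOf_pow_eq_sum {G M : Type*} [Group G] [Fintype G] [AddCommMonoid M] {g : G}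
    (hg : ∀ x, x ∈ Subgroup.zpowers g) (f : G → M) :
    ∑ i ∈ Finset.range (orderOf g), f (g ^ i) = ∑ x, f x := by
  classical
  rw [← IsCyclic.image_range_orderOf hg, Finset.sum_image]
  intro i hi j hj hij
  exact pow_injOn_Iio_orderOf (by simpa using hi) (by simpa using hj) hij

/-- For `p > 3` and `a ∈ F_q^×`:
`(1/(q−1)) Σ_{l=0}^{q−2} G_{−l}³ G_{3l} T^{−3l}(−3a)
  = (q²·φ(−3a)/(q−1)) Σ_{l=0}^{q−2} [G_{−2l}³ G_{6l} / (G_{−l}³ G_{3l})] · T^{−3l}(−3a)`,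
where `φ = T^{(q−1)/2}` is the quadratic character. -/
theorem sum_gauss_cubes_eq_ratio_sum
    (p r : ℕ) (hp : p.Prime) (hp3 : 3 < p) (hr : 0 < r)
    (F : Type) [Field F] [Fintype F] (hcard : Fintype.card F = p ^ r)
    (ψ : AddChar F ℂ) (hψ : ψ ≠ 1)
    (T : MulChar F ℂ) (hT : ∀ χ : MulChar F ℂ, χ ∈ Subgroup.zpowers T)
    (a : F) (ha : a ≠ 0) :
    (1 / ((p : ℂ) ^ r - 1)) *
        ∑ l ∈ Finset.range (p ^ r - 1),
          (gaussSum (T ^ (-(l : ℤ))) ψ) ^ 3 * gaussSum (T ^ (3 * (l : ℤ))) ψ *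
            (T ^ (-(3 * (l : ℤ)))) (-3 * a)
      = ((p : ℂ) ^ r) ^ 2 * (T ^ ((p ^ r - 1) / 2)) (-3 * a) / ((p : ℂ) ^ r - 1) *
          ∑ l ∈ Finset.range (p ^ r - 1),
            ((gaussSum (T ^ (-(2 * (l : ℤ)))) ψ) ^ 3 * gaussSum (T ^ (6 * (l : ℤ))) ψ /
                ((gaussSum (T ^ (-(l : ℤ))) ψ) ^ 3 * gaussSum (T ^ (3 * (l : ℤ))) ψ)) *
              (T ^ (-(3 * (l : ℤ)))) (-3 * a) := by
  have : Fact p.Prime := ⟨hp⟩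
  have hchar : ringChar F = p := by
    have : CharP F p := charP_of_card_eq_prime_pow hcard
    exact ringChar.eq F p
  have hF : ringChar F ≠ 2 := by omega
  generalize -3 * a = b
  have hord : orderOf T = p ^ r - 1 := by rw [MulChar.orderOf_eq_card_sub_one hT, hcard]
  have hodd : Odd (p ^ r) := (hp.odd_of_ne_two (by omega)).pow
  have hq1 : 1 < p ^ r := Nat.one_lt_pow hr.ne' hp.one_lt
  have hTφ : T ^ ((p ^ r - 1) / 2) = complexQuadraticChar F := by
    obtain ⟨m, hm⟩ := hodd
    have hpow : (T ^ ((p ^ r - 1) / 2)) ^ 2 = 1 := by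
      rw [← pow_mul, Nat.div_mul_cancel ⟨m, by omega⟩, ← hord, pow_orderOf_eq_one]
    refine (MulChar.eq_one_or_eq_complexQuadraticChar hpow).resolve_left ?_
    exact pow_ne_one_of_lt_orderOf (by omega) (by omega)
  have := Fintype.ofFinite (MulChar F ℂ)
  have hcardC : (Fintype.card F : ℂ) = (p : ℂ) ^ r := by rw [hcard, Nat.cast_pow]
  let g (χ : MulChar F ℂ) : ℂ := gaussSum χ⁻¹ ψ ^ 3 * gaussSum (χ ^ 3) ψ * (χ ^ 3)⁻¹ b
  have hleft : ∑ l ∈ Finset.range (p ^ r - 1),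
      (gaussSum (T ^ (-(l : ℤ))) ψ) ^ 3 * gaussSum (T ^ (3 * (l : ℤ))) ψ *
        (T ^ (-(3 * (l : ℤ)))) b = ∑ χ, g χ := by
    rw [← sum_range_orderOf_pow_eq_sum hT, hord]
    refine Finset.sum_congr rfl fun l _ ↦ ?_
    have h3 : T ^ (3 * (l : ℤ)) = (T ^ l) ^ 3 := by
      rw [← pow_mul, ← zpow_natCast]; congr 1; push_cast; ring
    rw [zpow_neg, zpow_neg, h3, zpow_natCast]
  have hright : ((p : ℂ) ^ r) ^ 2 * complexQuadraticChar F b * ∑ l ∈ Finset.range (p ^ r - 1),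
      ((gaussSum (T ^ (-(2 * (l : ℤ)))) ψ) ^ 3 * gaussSum (T ^ (6 * (l : ℤ))) ψ /
          ((gaussSum (T ^ (-(l : ℤ))) ψ) ^ 3 * gaussSum (T ^ (3 * (l : ℤ))) ψ)) *
        (T ^ (-(3 * (l : ℤ)))) b = ∑ χ, g (χ * complexQuadraticChar F) := by
    rw [← sum_range_orderOf_pow_eq_sum hT, hord, Finset.mul_sum]
    refine Finset.sum_congr rfl fun l _ ↦ ?_
    have h2 : T ^ (-(2 * (l : ℤ))) = (T ^ l)⁻¹ ^ 2 := by
      rw [inv_pow, ← pow_mul, zpow_neg, ← zpow_natCast]; congr 2; push_cast; ring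
    have h3 : T ^ (3 * (l : ℤ)) = (T ^ l) ^ 3 := by
      rw [← pow_mul, ← zpow_natCast]; congr 1; push_cast; ring
    have h6 : T ^ (6 * (l : ℤ)) = ((T ^ l) ^ 3) ^ 2 := by
      rw [← pow_mul, ← pow_mul, ← zpow_natCast]; congr 1; push_cast; ring
    have hη := complexQuadraticChar_isQuadratic (F := F)
    have hcube : ((T ^ l * complexQuadraticChar F) ^ 3)⁻¹ =
        ((T ^ l) ^ 3)⁻¹ * complexQuadraticChar F := by
      rw [mul_pow, pow_succ (complexQuadraticChar F) 2, hη.sq_eq_one, one_mul, mul_inv, hη.inv]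
    simp only [g]
    rw [zpow_neg T (l : ℤ), zpow_neg T (3 * (l : ℤ)), h2, h3, h6, zpow_natCast,
      ← gaussSum_cube_ratio_eq hF hψ, hcardC, hcube, MulChar.mul_apply]
    ring
  rw [hleft, hTφ, one_div_mul_eq_div, div_mul_eq_mul_div, hright]
  exact congrArg (· / _) (Equiv.sum_comp (Equiv.mulRight (complexQuadraticChar F)) g).symm
end

section
/- Let p > 5 be a prime, q = p^r with q ≡ 1 (mod 3), and let a ∈ F_q^× with a³ ≠ 1. Then the number of affine F_q-points of the Hessian curve C_a satisfies q · #C_a(F_q) = q² + 4q + 1 + 1/(q−1) − 6q·φ(−3) + (q²·φ(−3a)/(q−1)) Σ_{l=0, l≠(q−1)/2}^{q−2} [G_{−2l}³ G_{6l} / (G_{−l}³ G_{3l})] · T^{−3l}(−3a), as an identity of complex numbers (all Gauss sums G_k are nonzero in ℂ, so the quotients are well defined; indices of G and exponents of T are taken modulo q−1). -/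
open Finset

namespace HessianPointCount

section Counting

variable {F : Type} [Field F]

lemma apply_pow_three {η : MulChar F ℂ} (hη3 : η ^ 3 = 1) (y : Fˣ) : η ((y ^ 3 : Fˣ) : F) = 1 := by
  rw [Units.val_pow_eq_pow_val, map_pow, ← MulChar.pow_apply_coe, hη3, MulChar.one_apply_coe]

lemma sq_ne_one_of_cubic {η : MulChar F ℂ} (hη : η ≠ 1) (hη3 : η ^ 3 = 1) : η ^ 2 ≠ 1 := by
  intro h
  rw [pow_succ, h, one_mul] at hη3
  exact hη hη3

variable [Fintype F]

lemma exists_pow_three_of_apply_eq_one {η : MulChar F ℂ} (hη : η ≠ 1) (hη3 : η ^ 3 = 1) {c : Fˣ}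
    (hc : η c = 1) : ∃ y : Fˣ, y ^ 3 = c := by
  obtain ⟨g, hg⟩ := IsCyclic.exists_generator (α := Fˣ)
  have hg1 : η g ≠ 1 := fun h ↦ hη <| MulChar.eq_one_iff.mpr fun a ↦ by
    obtain ⟨k, rfl⟩ := mem_powers_iff_mem_zpowers.mpr (hg a)
    simp [h]
  have hord : orderOf (η g) = 3 := by
    refine orderOf_eq_prime ?_ hg1
    rw [← MulChar.pow_apply_coe, hη3, MulChar.one_apply_coe]
  obtain ⟨k, rfl⟩ := mem_powers_iff_mem_zpowers.mpr (hg c)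
  simp only [Units.val_pow_eq_pow_val, map_pow] at hc
  obtain ⟨m, rfl⟩ := hord ▸ orderOf_dvd_of_pow_eq_one hc
  exact ⟨g ^ m, by simp only [← pow_mul, mul_comm]⟩

/-- There is only one character of order two. -/
lemma eq_of_sq_eq_one {χ φ : MulChar F ℂ} (hχ : χ ≠ 1) (hχ2 : χ ^ 2 = 1) (hφ : φ ≠ 1)
    (hφ2 : φ ^ 2 = 1) : χ = φ := by
  obtain ⟨g, hg⟩ := IsCyclic.exists_generator (α := Fˣ)
  have key : ∀ {χ : MulChar F ℂ}, χ ≠ 1 → χ ^ 2 = 1 → χ g = -1 := by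
    intro χ hχ hχ2
    have h : χ g ^ 2 = 1 := by rw [← MulChar.pow_apply_coe, hχ2, MulChar.one_apply_coe]
    refine (mul_self_eq_one_iff.mp (by rw [← sq, h])).resolve_left fun h ↦ hχ <|
      MulChar.eq_one_iff.mpr fun a ↦ ?_
    obtain ⟨k, rfl⟩ := mem_powers_iff_mem_zpowers.mpr (hg a)
    simp [h]
  refine MulChar.ext fun a ↦ ?_
  obtain ⟨k, rfl⟩ := mem_powers_iff_mem_zpowers.mpr (hg a)
  simp [key hχ hχ2, key hφ hφ2]

lemma gaussSum_ne_zero_complex {ψ : AddChar F ℂ} (hψ : ψ ≠ 1) (χ : MulChar F ℂ) :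
    gaussSum χ ψ ≠ 0 := by
  by_cases hχ : χ = 1
  · rw [hχ, gaussSum_one_left hψ]
    norm_num
  · exact gaussSum_ne_zero_of_nontrivial (by simp) hχ (AddChar.IsPrimitive.of_ne_one hψ)

lemma gaussSum_quadratic_pow_four {ψ : AddChar F ℂ} (hψ : ψ ≠ 1) {φ : MulChar F ℂ} (hφ : φ ≠ 1)
    (hφ2 : φ ^ 2 = 1) : gaussSum φ ψ ^ 4 = (Fintype.card F : ℂ) ^ 2 := by
  have h := gaussSum_mul_gaussSum_eq_card hφ (AddChar.IsPrimitive.of_ne_one hψ)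
  have hinv : φ⁻¹ = φ := inv_eq_of_mul_eq_one_right (by rw [← sq, hφ2])
  rw [hinv, mul_comm] at h
  have hm := gaussSum_mulShift φ ψ (-1)
  have h1 : φ ((-1 : Fˣ) : F) ^ 2 = 1 := by
    rw [← MulChar.pow_apply_coe, hφ2, MulChar.one_apply_coe]
  have h2 : AddChar.mulShift ψ ((-1 : Fˣ) : F) = ψ⁻¹ := by
    ext x
    simp [AddChar.mulShift_apply, AddChar.inv_apply]
  rw [h2] at hm
  rw [← h, ← hm]
  linear_combination gaussSum φ ψ⁻¹ ^ 4 * φ ((-1 : Fˣ) : F) ^ 2 * h1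

lemma natCast_ne_zero_of_lt {p r n : ℕ} (hp : p.Prime) (hcard : Fintype.card F = p ^ r)
    (hn : 0 < n) (hnp : n < p) : (n : F) ≠ 0 := by
  obtain ⟨s, hs, hcard'⟩ := FiniteField.card F (ringChar F)
  have hr : r ≠ 0 := by
    rintro rfl
    exact (Fintype.one_lt_card (α := F)).ne' (by simpa using hcard)
  have hpd : p ∣ ringChar F := hp.dvd_of_dvd_pow
    (hcard' ▸ hcard ▸ dvd_pow_self p hr : p ∣ ringChar F ^ (s : ℕ))
  rw [Ne, ringChar.spec]
  exact fun h ↦ (Nat.le_of_dvd hn (hpd.trans h)).not_gt hnp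

variable [DecidableEq F]

/-- The number of cube roots of a unit, as a complex number. -/
noncomputable def cubeRootCount (c : Fˣ) : ℂ := ∑ t : Fˣ, if t ^ 3 = c then 1 else 0

/-- The sum of `η(v/w)` over the unit triples `(u, v, w)` with product `c` and sum `e`. -/
noncomputable def tripleSum (η : MulChar F ℂ) (c : Fˣ) (e : F) : ℂ :=
  ∑ x : Fˣ × Fˣ × Fˣ,
    if x.1 * x.2.1 * x.2.2 = c ∧ (x.1 : F) + x.2.1 + x.2.2 = e then
      η x.2.1 * η⁻¹ x.2.2 else 0

lemma sum_units_mulChar {χ : MulChar F ℂ} (hχ : χ ≠ 1) : ∑ u : Fˣ, χ u = 0 := by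
  obtain ⟨a, ha⟩ := MulChar.ne_one_iff.mp hχ
  refine eq_zero_of_mul_eq_self_left ha ?_
  rw [mul_sum]
  exact Fintype.sum_equiv (Equiv.mulLeft a) _ _ fun x ↦ by simp

lemma card_units_complex : (Fintype.card Fˣ : ℂ) = Fintype.card F - 1 := by
  rw [Fintype.card_units, Nat.cast_sub Fintype.card_pos, Nat.cast_one]

lemma sum_field_eq_zero_add_units {M : Type*} [AddCommMonoid M] (f : F → M) :
    ∑ x : F, f x = f 0 + ∑ u : Fˣ, f u := by
  rw [← Fintype.sum_equiv (unitsEquivNeZero (G₀ := F)).symm (fun x ↦ f x) (fun u ↦ f u)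
      (fun x ↦ by simp [unitsEquivNeZero]),
    ← Finset.add_sum_erase univ f (mem_univ 0)]
  congr 1
  rw [← Finset.sum_subtype (univ.erase 0) (by simp) f]

lemma sum_units_addChar {ψ : AddChar F ℂ} (hψ : ψ ≠ 1) (b : F) :
    ∑ k : Fˣ, ψ (k * b) = (if b = 0 then (Fintype.card F : ℂ) else 0) - 1 := by
  have h := AddChar.sum_mulShift b (AddChar.IsPrimitive.of_ne_one hψ)
  rw [sum_field_eq_zero_add_units] at h
  simp only [zero_mul, AddChar.map_zero_eq_one] at h
  push_cast at h
  rw [← h]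
  ring

lemma star_tripleSum (η : MulChar F ℂ) (c : Fˣ) (e : F) :
    star (tripleSum η c e) = tripleSum η c e := by
  rw [tripleSum, star_sum]
  refine Fintype.sum_equiv ((Equiv.refl _).prodCongr (Equiv.prodComm _ _)) _ _ fun x ↦ ?_
  rw [apply_ite star, star_zero, star_mul, MulChar.star_apply', MulChar.star_apply', inv_inv]
  simp only [Equiv.prodCongr_apply, Equiv.coe_refl, Prod.map, Equiv.prodComm_apply, id,
    Prod.fst_swap, Prod.snd_swap]
  refine if_congr ?_ rfl rfl
  rw [mul_right_comm, add_right_comm]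

lemma card_mul_count_linear {ψ : AddChar F ℂ} (hψ : ψ ≠ 1) (a b c : F) :
    (Fintype.card F : ℂ) * ∑ y : Fˣ × Fˣ × Fˣ,
        (if y.1 * a + y.2.1 * b + y.2.2 * c = 0 then (1 : ℂ) else 0) =
      (Fintype.card F - 1) ^ 3 + (Fintype.card F - 1) *
        ((if a = 0 then (Fintype.card F : ℂ) else 0) - 1) *
        ((if b = 0 then (Fintype.card F : ℂ) else 0) - 1) *
        ((if c = 0 then (Fintype.card F : ℂ) else 0) - 1) := by
  have key : ∀ k : Fˣ, ∑ y : Fˣ × Fˣ × Fˣ, ψ (k * (y.1 * a + y.2.1 * b + y.2.2 * c)) =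
      ((if a = 0 then (Fintype.card F : ℂ) else 0) - 1) *
        ((if b = 0 then (Fintype.card F : ℂ) else 0) - 1) *
        ((if c = 0 then (Fintype.card F : ℂ) else 0) - 1) := by
    intro k
    have h1 : ∀ d : F, ∑ u : Fˣ, ψ (u * (k * d)) =
        (if d = 0 then (Fintype.card F : ℂ) else 0) - 1 := by
      intro d
      rw [sum_units_addChar hψ]
      simp
    rw [← h1 a, ← h1 b, ← h1 c, mul_assoc, sum_mul, Fintype.sum_prod_type]
    refine sum_congr rfl fun u _ ↦ ?_
    rw [sum_mul_sum, Fintype.sum_prod_type, mul_sum]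
    refine sum_congr rfl fun v _ ↦ ?_
    rw [mul_sum]
    refine sum_congr rfl fun w _ ↦ ?_
    rw [← AddChar.map_add_eq_mul, ← AddChar.map_add_eq_mul]
    congr 1
    ring
  have h2 : ∀ s : F, (Fintype.card F : ℂ) * (if s = 0 then (1 : ℂ) else 0) =
      1 + ∑ k : Fˣ, ψ (k * s) := by
    intro s
    rw [sum_units_addChar hψ, mul_ite, mul_one, mul_zero]
    ring
  rw [mul_sum]
  simp_rw [h2, sum_add_distrib]
  rw [sum_comm, sum_congr rfl fun k _ ↦ key k]
  simp only [sum_const, card_univ, Fintype.card_prod, nsmul_eq_mul, Nat.cast_mul,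
    card_units_complex]
  ring

lemma sum_mul_ite_sub_one {G : Type*} [Fintype G] [DecidableEq G] (f : G → ℂ) (g : G) (q : ℂ) :
    ∑ x, f x * ((if x = g then q else 0) - 1) = f g * q - ∑ x, f x := by
  simp [mul_sub, sum_sub_distrib]

/-- The second moment of `tripleSum`. -/
lemma sum_tripleSum_sq {ψ : AddChar F ℂ} (hψ : ψ ≠ 1) {η : MulChar F ℂ} (hη : η ≠ 1)
    (hη2 : η ^ 2 ≠ 1) :
    ∑ c : Fˣ, ∑ e : F, tripleSum η c e ^ 2 =
      (Fintype.card F - 1) * Fintype.card F * (Fintype.card F - 3) := by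
  set q : ℂ := (Fintype.card F : ℂ) with hq
  have hq0 : q ≠ 0 := by simp [hq]
  set X : Fˣ × Fˣ × Fˣ → ℂ := fun x ↦ η x.2.1 * η⁻¹ x.2.2 with hX
  have h1 : ∑ c : Fˣ, ∑ e : F, tripleSum η c e ^ 2 =
      ∑ y : Fˣ × Fˣ × Fˣ, ∑ x : Fˣ × Fˣ × Fˣ,
        if x.1 * x.2.1 * x.2.2 = y.1 * y.2.1 * y.2.2 ∧
          (x.1 : F) + x.2.1 + x.2.2 = y.1 + y.2.1 + y.2.2 then X x * star (X y) else 0 := by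
    have h : ∀ c e, tripleSum η c e ^ 2 = ∑ y : Fˣ × Fˣ × Fˣ, ∑ x : Fˣ × Fˣ × Fˣ,
        if y.1 * y.2.1 * y.2.2 = c then if (y.1 : F) + y.2.1 + y.2.2 = e then
        if x.1 * x.2.1 * x.2.2 = c ∧ (x.1 : F) + x.2.1 + x.2.2 = e then
          X x * star (X y) else 0 else 0 else 0 := by
      intro c e
      rw [sq]
      nth_rewrite 2 [← star_tripleSum]
      rw [tripleSum, star_sum, sum_mul_sum, sum_comm]
      refine sum_congr rfl fun y _ ↦ sum_congr rfl fun x _ ↦ ?_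
      split_ifs <;> simp_all
    simp_rw [h]
    rw [sum_congr rfl fun c _ ↦ sum_comm, sum_comm]
    refine sum_congr rfl fun y _ ↦ ?_
    rw [sum_congr rfl fun c _ ↦ sum_comm, sum_comm]
    refine sum_congr rfl fun x _ ↦ ?_
    simp [ite_and, sum_ite_eq, sum_ite_irrel]
  have h2 : ∑ c : Fˣ, ∑ e : F, tripleSum η c e ^ 2 =
      ∑ z : Fˣ × Fˣ × Fˣ, if z.1 * z.2.1 * z.2.2 = 1 then X z *
        ∑ y : Fˣ × Fˣ × Fˣ, (if y.1 * ((z.1 : F) - 1) + y.2.1 * ((z.2.1 : F) - 1) +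
          y.2.2 * ((z.2.2 : F) - 1) = 0 then (1 : ℂ) else 0) else 0 := by
    have hX1 : ∀ y, X y * star (X y) = 1 := by
      intro y
      simp only [hX, star_mul, MulChar.star_apply', inv_inv]
      rw [mul_comm (η _) (η⁻¹ _), mul_mul_mul_comm, ← MulChar.mul_apply, ← MulChar.mul_apply,
        inv_mul_cancel, mul_inv_cancel, MulChar.one_apply_coe, MulChar.one_apply_coe, one_mul]
    rw [h1]
    have h3 : ∀ y : Fˣ × Fˣ × Fˣ, (∑ x : Fˣ × Fˣ × Fˣ,
        if x.1 * x.2.1 * x.2.2 = y.1 * y.2.1 * y.2.2 ∧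
          (x.1 : F) + x.2.1 + x.2.2 = y.1 + y.2.1 + y.2.2 then X x * star (X y) else 0) =
        ∑ z : Fˣ × Fˣ × Fˣ, if z.1 * z.2.1 * z.2.2 = 1 then
          X z * (if y.1 * ((z.1 : F) - 1) + y.2.1 * ((z.2.1 : F) - 1) +
          y.2.2 * ((z.2.2 : F) - 1) = 0 then (1 : ℂ) else 0) else 0 := by
      intro y
      symm
      refine Fintype.sum_equiv (Equiv.mulLeft y) _ _ fun z ↦ ?_
      have e1 : y.1 * z.1 * (y.2.1 * z.2.1) * (y.2.2 * z.2.2) = y.1 * y.2.1 * y.2.2 ↔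
          z.1 * z.2.1 * z.2.2 = 1 := by
        rw [show y.1 * z.1 * (y.2.1 * z.2.1) * (y.2.2 * z.2.2) =
          y.1 * y.2.1 * y.2.2 * (z.1 * z.2.1 * z.2.2) by
            simp only [mul_comm, mul_left_comm], mul_eq_left]
      have e2 : ((y.1 * z.1 : Fˣ) : F) + (y.2.1 * z.2.1 : Fˣ) + (y.2.2 * z.2.2 : Fˣ) =
          y.1 + y.2.1 + y.2.2 ↔ y.1 * ((z.1 : F) - 1) + y.2.1 * ((z.2.1 : F) - 1) +
          y.2.2 * ((z.2.2 : F) - 1) = 0 := by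
        rw [← sub_eq_zero]
        push_cast
        ring_nf
      have e3 : X (y * z) = X y * X z := by
        simp only [hX, Prod.snd_mul, Prod.fst_mul, Units.val_mul, map_mul]
        ring
      have e4 : X y * X z * star (X y) = X z := by rw [mul_right_comm, hX1, one_mul]
      simp only [Equiv.coe_mulLeft, Prod.fst_mul, Prod.snd_mul, e1, e2, e3, e4, mul_ite, mul_one,
        mul_zero, ite_and]
    rw [sum_congr rfl fun y _ ↦ h3 y, sum_comm]
    refine sum_congr rfl fun z _ ↦ ?_
    rw [sum_ite_irrel, mul_sum]
    simp
  have hinv : η⁻¹ ≠ 1 := inv_ne_one.mpr hη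
  have h4 : q * ∑ c : Fˣ, ∑ e : F, tripleSum η c e ^ 2 =
      ∑ v : Fˣ, ∑ w : Fˣ, η v * η⁻¹ w * ((q - 1) ^ 3 + (q - 1) *
        ((if w = v⁻¹ then q else 0) - 1) * ((if v = 1 then q else 0) - 1) *
        ((if w = 1 then q else 0) - 1)) := by
    rw [h2, mul_sum, Fintype.sum_prod_type, sum_comm, Fintype.sum_prod_type]
    refine sum_congr rfl fun v _ ↦ sum_congr rfl fun w _ ↦ ?_
    rw [sum_eq_single (v * w)⁻¹]
    · rw [if_pos (by simp [mul_assoc]), mul_left_comm, card_mul_count_linear hψ]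
      simp only [sub_eq_zero, Units.val_eq_one, inv_eq_one, mul_eq_one_iff_eq_inv', ← hq]
      rfl
    · intro u _ hu
      rw [if_neg, mul_zero]
      rwa [mul_assoc, mul_eq_one_iff_eq_inv]
    · simp
  have h5 : ∀ v : Fˣ, ∑ w : Fˣ, η v * η⁻¹ w * ((q - 1) ^ 3 + (q - 1) *
        ((if w = v⁻¹ then q else 0) - 1) * ((if v = 1 then q else 0) - 1) *
        ((if w = 1 then q else 0) - 1)) =
        (q - 1) * q * ((η v * ((if v = 1 then q else 0) - 1) - (η ^ 2) v) *
          ((if v = 1 then q else 0) - 1)) := by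
    intro v
    have e1 : ∀ w : Fˣ, η v * η⁻¹ w * ((q - 1) ^ 3 + (q - 1) *
        ((if w = v⁻¹ then q else 0) - 1) * ((if v = 1 then q else 0) - 1) *
        ((if w = 1 then q else 0) - 1)) = (q - 1) ^ 3 * η v * η⁻¹ w + 
        (q - 1) * η v * ((if v = 1 then q else 0) - 1) * ((η⁻¹ w *
         ((if w = v⁻¹ then q else 0) - 1)) * ((if w = 1 then q else 0) - 1)) := by
      intro w; ring
    rw [sum_congr rfl fun w _ ↦ e1 w, sum_add_distrib, ← mul_sum, ← mul_sum,
      sum_units_mulChar hinv, sum_mul_ite_sub_one, sum_mul_ite_sub_one, sum_units_mulChar hinv]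
    have e2 : η⁻¹ ((v⁻¹ : Fˣ) : F) = η v := by
      rw [MulChar.inv_apply', ← Units.val_inv_eq_inv_val, inv_inv]
    rw [e2, Units.val_one, map_one, MulChar.pow_apply_coe]
    simp only [eq_comm (a := (1 : Fˣ)), inv_eq_one]
    ring
  rw [sum_congr rfl fun v _ ↦ h5 v, ← mul_sum, sum_mul_ite_sub_one] at h4
  rw [sum_sub_distrib, sum_mul_ite_sub_one, sum_units_mulChar hη2,
    sum_units_mulChar hη] at h4
  apply mul_left_cancel₀ hq0
  rw [h4]
  simp
  ring

lemma cubeRootCount_pow_three (h3 : (3 : F) ≠ 0) {ω : F}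
    (hω : ω ^ 2 + ω + 1 = 0) (y : Fˣ) : cubeRootCount (y ^ 3) = 3 := by
  have hω0 : ω ≠ 0 := by rintro rfl; simp at hω
  have hω3 : ω ^ 3 = 1 := by linear_combination (ω - 1) * hω
  have hω1 : ω ≠ 1 := by
    rintro rfl
    exact h3 (by linear_combination hω)
  set z : Fˣ := Units.mk0 ω hω0
  have hz1 : z ≠ 1 := fun h ↦ hω1 (by simpa [z] using congrArg Units.val h)
  have hz3 : z ^ 3 = 1 := Units.ext (by simpa [z] using hω3)
  have hz2 : z ^ 2 ≠ 1 := fun h ↦ hz1 (by rw [← hz3, pow_succ, h, one_mul])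
  have hz21 : z ^ 2 ≠ z := fun h ↦ hz1 (by rwa [sq, mul_eq_left] at h)
  have hset : (univ.filter fun t : Fˣ ↦ t ^ 3 = y ^ 3) = {y, y * z, y * z ^ 2} := by
    ext t
    simp only [mem_filter, mem_univ, true_and, mem_insert, mem_singleton]
    constructor
    · intro h
      have h' : ((t : F) - y) * ((t - y * ω) * (t - y * ω ^ 2)) = 0 := by
        have h0 : (t : F) ^ 3 = y ^ 3 := by simpa using congrArg Units.val h
        linear_combination h0 + (t * (y : F) ^ 2 * ω - (t : F) ^ 2 * y) * hω +
          (t * (y : F) ^ 2 - y ^ 3 - t * (y : F) ^ 2) * hω3 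
      rcases mul_eq_zero.mp h' with h' | h'
      · exact .inl (Units.ext (sub_eq_zero.mp h'))
      rcases mul_eq_zero.mp h' with h' | h'
      · exact .inr (.inl (Units.ext (by simpa [z] using sub_eq_zero.mp h')))
      · exact .inr (.inr (Units.ext (by simpa [z] using sub_eq_zero.mp h')))
    · rintro (rfl | rfl | rfl)
      · rfl
      · rw [mul_pow, hz3, mul_one]
      · rw [mul_pow, ← pow_mul, mul_comm 2, pow_mul, hz3, one_pow, mul_one]
  rw [cubeRootCount, sum_boole, hset, card_eq_three.mpr ⟨_, _, _, ?_, ?_, ?_, rfl⟩]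
  · norm_num
  · simpa [eq_comm] using hz1
  · simpa [eq_comm] using hz2
  · simpa [eq_comm] using hz21

lemma cubeRootCount_eq (h3 : (3 : F) ≠ 0) {ω : F} (hω : ω ^ 2 + ω + 1 = 0)
    {η : MulChar F ℂ} (hη : η ≠ 1) (hη3 : η ^ 3 = 1) (c : Fˣ) :
    cubeRootCount c = 1 + η c + η⁻¹ c := by
  have hinv : η⁻¹ = η ^ 2 := inv_eq_of_mul_eq_one_right (by rw [← pow_succ', hη3])
  by_cases hc : ∃ y : Fˣ, y ^ 3 = c
  · obtain ⟨y, rfl⟩ := hc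
    rw [cubeRootCount_pow_three h3 hω, hinv, MulChar.pow_apply_coe, apply_pow_three hη3]
    norm_num
  · have h1 : η c ≠ 1 := fun h ↦ hc (exists_pow_three_of_apply_eq_one hη hη3 h)
    have h0 : cubeRootCount c = 0 :=
      sum_eq_zero fun t _ ↦ if_neg fun h ↦ hc ⟨t, h⟩
    have h4 : η c ^ 3 = 1 := by rw [← MulChar.pow_apply_coe, hη3, MulChar.one_apply_coe]
    rw [h0, hinv, MulChar.pow_apply_coe]
    apply mul_left_cancel₀ (sub_ne_zero.mpr h1)
    linear_combination -h4

lemma card_nonnodal_parameters (h3 : (3 : F) ≠ 0) {ω : F}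
    (hω : ω ^ 2 + ω + 1 = 0) :
    ((univ.filter fun x : F ↦ x ≠ 0 ∧ -1 - x ≠ 0 ∧ x ^ 2 + x + 1 ≠ 0).card : ℂ) =
      Fintype.card F - 4 := by
  have hset : (univ.filter fun x : F ↦ x ≠ 0 ∧ -1 - x ≠ 0 ∧ x ^ 2 + x + 1 ≠ 0) =
      ({0, -1, ω, -1 - ω} : Finset F)ᶜ := by
    ext x
    simp only [mem_filter, mem_univ, true_and, mem_compl, mem_insert, mem_singleton, not_or,
      ne_eq]
    have e1 : -1 - x = 0 ↔ x = -1 := by rw [sub_eq_zero, eq_comm]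
    have e2 : x ^ 2 + x + 1 = 0 ↔ x = ω ∨ x = -1 - ω := by
      rw [← sub_eq_zero (a := x), ← sub_eq_zero (a := x), ← mul_eq_zero]
      exact ⟨fun h ↦ by linear_combination h - hω, fun h ↦ by linear_combination h + hω⟩
    rw [e1, e2, not_or]
  have hω0 : ω ≠ 0 := by rintro rfl; simp at hω
  have hω1 : -1 ≠ ω := by rintro rfl; simp at hω
  have hω2 : ω ≠ -1 - ω := fun h ↦ h3 (by linear_combination 4 * hω - (2 * ω + 1) * h)
  have hcard : ({0, -1, ω, -1 - ω} : Finset F).card = 4 := by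
    rw [card_insert_of_notMem, card_insert_of_notMem, card_pair hω2]
    · simp only [mem_insert, mem_singleton, not_or]
      exact ⟨hω1, fun h ↦ hω0 (by linear_combination h)⟩
    · simp only [mem_insert, mem_singleton, not_or]
      exact ⟨by simp, hω0.symm, fun h ↦ hω1 (by linear_combination -h)⟩
  rw [hset, card_compl, hcard, Nat.cast_sub (hcard ▸ card_le_univ _)]
  norm_num

/-- The cubic character is trivial on the nodal cubic `(u + v + 1)³ = 27 * u * v`. -/
lemma sum_nodal (h2 : (2 : F) ≠ 0) (h3 : (3 : F) ≠ 0) {ω : F} (hω : ω ^ 2 + ω + 1 = 0)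
    {η : MulChar F ℂ} (hη3 : η ^ 3 = 1) :
    ∑ p : Fˣ × Fˣ, (if ((p.1 : F) + p.2 + 1) ^ 3 = 27 * (p.1 * p.2) then η p.2 else 0) =
      Fintype.card F - 3 := by
  rw [← add_sum_erase _ _ (mem_univ (1 : Fˣ × Fˣ)), ← sum_filter]
  have hone : (if (((1 : Fˣ × Fˣ).1 : F) + (1 : Fˣ × Fˣ).2 + 1) ^ 3 =
      27 * ((1 : Fˣ × Fˣ).1 * (1 : Fˣ × Fˣ).2) then η (1 : Fˣ × Fˣ).2 else 0) = 1 := by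
    rw [if_pos (by norm_num)]
    simp
  rw [hone]
  have hbij : ∑ p ∈ (univ.erase (1 : Fˣ × Fˣ)).filter
        (fun p ↦ ((p.1 : F) + p.2 + 1) ^ 3 = 27 * (p.1 * p.2)), η p.2 =
      ∑ x ∈ univ.filter fun x : F ↦ x ≠ 0 ∧ -1 - x ≠ 0 ∧ x ^ 2 + x + 1 ≠ 0, (1 : ℂ) := by
    symm
    refine sum_bij (fun x hx ↦ (Units.mk0 x (mem_filter.mp hx).2.1 ^ 3,
      Units.mk0 (-1 - x) (mem_filter.mp hx).2.2.1 ^ 3)) ?_ ?_ ?_ ?_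
    · intro x hx
      obtain ⟨-, hx0, hx1, hx2⟩ := mem_filter.mp hx
      simp only [mem_filter, mem_erase, mem_univ, and_true, Units.val_pow_eq_pow_val,
        Units.val_mk0]
      refine ⟨fun h ↦ hx2 ?_, by ring⟩
      have ha : x ^ 3 = 1 := by simpa using congrArg (fun p : Fˣ × Fˣ ↦ (p.1 : F)) h
      have hb : (-1 - x) ^ 3 = 1 := by simpa using congrArg (fun p : Fˣ × Fˣ ↦ (p.2 : F)) h
      apply mul_left_cancel₀ h3
      linear_combination -ha - hb
    · intro x hx y hy h
      obtain ⟨-, -, -, hx2⟩ := mem_filter.mp hx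
      have ha : x ^ 3 = y ^ 3 := by simpa using congrArg (fun p : Fˣ × Fˣ ↦ (p.1 : F)) h
      have hb : (-1 - x) ^ 3 = (-1 - y) ^ 3 := by
        simpa using congrArg (fun p : Fˣ × Fˣ ↦ (p.2 : F)) h
      have hc : x ^ 2 + x = y ^ 2 + y := by
        apply mul_left_cancel₀ h3
        linear_combination -ha - hb
      have hd : (x - y) * (2 * (x ^ 2 + x + 1)) = 0 := by
        linear_combination ha - hb - (2 * y + 1) * hc
      rcases mul_eq_zero.mp hd with h | h
      · exact sub_eq_zero.mp h
      · exact absurd h (mul_ne_zero h2 hx2)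
    · rintro ⟨u, v⟩ hp
      simp only [mem_filter, mem_erase, mem_univ, and_true] at hp
      obtain ⟨hne, hp⟩ := hp
      obtain ⟨t, ht⟩ : ∃ t : F, 3 * t = u + v + 1 := ⟨(u + v + 1) / 3, by field_simp⟩
      have huv : (u : F) * v = t ^ 3 := by
        have h27 : (27 : F) ≠ 0 := by
          rw [show (27 : F) = 3 ^ 3 by norm_num]
          exact pow_ne_zero 3 h3
        apply mul_left_cancel₀ h27
        rw [← hp, ← ht]
        ring
      have ht1 : 1 - t ≠ 0 := by
        intro h
        have ht' : t = 1 := by linear_combination -h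
        subst ht'
        have hu : ((u : F) - 1) ^ 2 = 0 := by linear_combination (-(u : F)) * ht - huv
        have hu1 : (u : F) = 1 := sub_eq_zero.mp (pow_eq_zero_iff two_ne_zero |>.mp hu)
        refine hne (Prod.ext (Units.ext hu1) (Units.ext ?_))
        simp only [Prod.snd_one, Units.val_one]
        linear_combination -ht - hu1
      obtain ⟨x, hx⟩ : ∃ x : F, (2 * x + 1) * (1 - t) = u - v :=
        ⟨((u - v) / (1 - t) - 1) / 2, by field_simp; ring⟩
      have hd : (2 * x + 1) ^ 2 = 1 - 4 * t := by
        apply mul_left_cancel₀ (pow_ne_zero 2 ht1)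
        linear_combination ((2 * x + 1) * (1 - t) + u - v) * hx - 4 * huv +
          (-(3 * t - 1 + (u + v : F))) * ht
      have h4 : (4 : F) ≠ 0 := by
        rw [show (4 : F) = 2 ^ 2 by norm_num]
        exact pow_ne_zero 2 h2
      have hxt : x ^ 2 + x = -t := by
        apply mul_left_cancel₀ h4
        linear_combination hd
      have hu : x ^ 3 = u := by
        apply mul_left_cancel₀ h2
        linear_combination (2 * x - 2) * hxt + hx + ht
      have hv : (-1 - x) ^ 3 = v := by
        linear_combination (-3) * hxt - hu + ht
      have hx0 : x ≠ 0 := by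
        rintro rfl
        exact u.ne_zero (by simpa using hu.symm)
      have hx1 : -1 - x ≠ 0 := by
        intro h
        rw [h] at hv
        exact v.ne_zero (by simpa using hv.symm)
      refine ⟨x, ?_, Prod.ext (Units.ext (by simpa using hu)) (Units.ext (by simpa using hv))⟩
      simp only [mem_filter, mem_univ, true_and]
      refine ⟨hx0, hx1, fun h ↦ ht1 ?_⟩
      linear_combination h - hxt
    · intro x hx
      rw [apply_pow_three hη3]
  rw [hbij, sum_const, nsmul_eq_mul, mul_one, card_nonnodal_parameters h3 hω]
  ring

lemma sum_nodal_cone (h2 : (2 : F) ≠ 0) (h3 : (3 : F) ≠ 0) {ω : F} (hω : ω ^ 2 + ω + 1 = 0)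
    {η : MulChar F ℂ} (hη3 : η ^ 3 = 1) :
    ∑ x : Fˣ × Fˣ × Fˣ, (if ((x.1 : F) + x.2.1 + x.2.2) ^ 3 = 27 * (x.1 * x.2.1 * x.2.2) then
        η x.2.1 * η⁻¹ x.2.2 else 0) = (Fintype.card F - 1) * (Fintype.card F - 3) := by
  rw [← sum_nodal h2 h3 hω hη3, ← card_units_complex, ← nsmul_eq_mul, ← card_univ, ← sum_const]
  simp_rw [Fintype.sum_prod_type]
  rw [sum_congr rfl fun u _ ↦ sum_comm, sum_comm]
  refine sum_congr rfl fun w _ ↦ ?_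
  rw [← Equiv.sum_comp (Equiv.mulRight w)]
  refine sum_congr rfl fun u _ ↦ ?_
  rw [← Equiv.sum_comp (Equiv.mulRight w)]
  refine sum_congr rfl fun v _ ↦ ?_
  simp only [Equiv.coe_mulRight, Units.val_mul]
  refine if_congr ?_ ?_ rfl
  · rw [← mul_right_inj' (pow_ne_zero 3 w.ne_zero) (b := ((u : F) + v + 1) ^ 3)]
    ring_nf
  · rw [map_mul, mul_assoc, ← MulChar.mul_apply, mul_inv_cancel, MulChar.one_apply_coe, mul_one]

lemma cubeRootCount_sq (h3 : (3 : F) ≠ 0) {ω : F} (hω : ω ^ 2 + ω + 1 = 0) (c : Fˣ) :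
    cubeRootCount c ^ 2 = 3 * cubeRootCount c := by
  by_cases hc : ∃ y : Fˣ, y ^ 3 = c
  · obtain ⟨y, rfl⟩ := hc
    rw [cubeRootCount_pow_three h3 hω]
    norm_num
  · have h0 : cubeRootCount c = 0 :=
      sum_eq_zero fun t _ ↦ if_neg fun h ↦ hc ⟨t, h⟩
    simp [h0]

lemma sum_cubeRootCount : ∑ c : Fˣ, cubeRootCount c = Fintype.card F - 1 := by
  simp_rw [cubeRootCount]
  rw [sum_comm]
  simp [card_units_complex]

lemma sum_pow_three_eq (h3 : (3 : F) ≠ 0) (c : Fˣ) :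
    ∑ e : F, (if e ^ 3 = 27 * c then (1 : ℂ) else 0) = cubeRootCount c := by
  have h27 : (27 : F) = 3 ^ 3 := by norm_num
  rw [sum_field_eq_zero_add_units, if_neg, zero_add, cubeRootCount,
    ← Equiv.sum_comp (Equiv.mulLeft (Units.mk0 (3 : F) h3))]
  · refine sum_congr rfl fun t _ ↦ if_congr ?_ rfl rfl
    rw [Equiv.coe_mulLeft, Units.val_mul, Units.val_mk0, mul_pow, h27,
      mul_right_inj' (pow_ne_zero 3 h3), ← Units.val_pow_eq_pow_val, Units.val_inj]
  · rw [zero_pow three_ne_zero, h27]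
    exact (mul_ne_zero (pow_ne_zero 3 h3) c.ne_zero).symm

/-- The cubic Hasse–Davenport relation in additive form. -/
lemma tripleSum_eq {ψ : AddChar F ℂ} (hψ : ψ ≠ 1) (h2 : (2 : F) ≠ 0) (h3 : (3 : F) ≠ 0) {ω : F}
    (hω : ω ^ 2 + ω + 1 = 0) {η : MulChar F ℂ} (hη : η ≠ 1) (hη3 : η ^ 3 = 1) (c : Fˣ) (e : F) :
    tripleSum η c e =
      (if e ^ 3 = 27 * c then (Fintype.card F : ℂ) else 0) - cubeRootCount c := by
  have hη2 := sq_ne_one_of_cubic hη hη3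
  set q : ℂ := (Fintype.card F : ℂ) with hq
  set t : Fˣ → F → ℂ := fun c e ↦ (if e ^ 3 = 27 * c then q else 0) - cubeRootCount c with ht
  have htt : ∑ c : Fˣ, ∑ e : F, t c e ^ 2 = (q - 1) * q * (q - 3) := by
    have h : ∀ c : Fˣ, ∑ e : F, t c e ^ 2 = (q ^ 2 - 3 * q) * cubeRootCount c := by
      intro c
      have h' : ∀ e : F, t c e ^ 2 = (q ^ 2 - 2 * q * cubeRootCount c) *
          (if e ^ 3 = 27 * c then 1 else 0) + cubeRootCount c ^ 2 := by
        intro e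
        simp only [ht]
        split_ifs <;> ring
      simp_rw [h']
      rw [sum_add_distrib, ← mul_sum, sum_pow_three_eq h3, sum_const, card_univ, nsmul_eq_mul, ← hq]
      linear_combination (-q) * cubeRootCount_sq h3 hω c
    simp_rw [h]
    rw [← mul_sum, sum_cubeRootCount]
    ring
  have hX : ∑ x : Fˣ × Fˣ × Fˣ, η x.2.1 * η⁻¹ x.2.2 * cubeRootCount (x.1 * x.2.1 * x.2.2) = 0 := by
    obtain ⟨g, hg⟩ := MulChar.ne_one_iff.mp hη2
    refine eq_zero_of_mul_eq_self_left hg ?_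
    rw [mul_sum]
    refine Fintype.sum_equiv (Equiv.mulLeft (1, g, g⁻¹)) _ _ fun x ↦ ?_
    have e1 : x.1 * (g * x.2.1) * (g⁻¹ * x.2.2) = x.1 * x.2.1 * x.2.2 := by
      rw [mul_mul_mul_comm, mul_assoc g, mul_assoc x.1, inv_mul_cancel_left, mul_assoc]
    have e2 : η⁻¹ ((g⁻¹ : Fˣ) : F) = η g := by
      rw [MulChar.inv_apply', ← Units.val_inv_eq_inv_val, inv_inv]
    simp only [Equiv.coe_mulLeft, Prod.fst_mul, Prod.snd_mul, one_mul, e1, Units.val_mul, map_mul,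
      e2, MulChar.pow_apply_coe]
    ring
  have hWt : ∑ c : Fˣ, ∑ e : F, tripleSum η c e * t c e = (q - 1) * q * (q - 3) := by
    have h : ∑ c : Fˣ, ∑ e : F, tripleSum η c e * t c e =
        ∑ x : Fˣ × Fˣ × Fˣ, η x.2.1 * η⁻¹ x.2.2 *
          t (x.1 * x.2.1 * x.2.2) ((x.1 : F) + x.2.1 + x.2.2) := by
      simp_rw [tripleSum, sum_mul]
      rw [sum_congr rfl fun c _ ↦ sum_comm, sum_comm]
      refine sum_congr rfl fun x _ ↦ ?_
      simp [ite_and, ite_mul, sum_ite_irrel]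
    have h' : ∀ x : Fˣ × Fˣ × Fˣ, η x.2.1 * η⁻¹ x.2.2 *
          t (x.1 * x.2.1 * x.2.2) ((x.1 : F) + x.2.1 + x.2.2) =
        q * (if ((x.1 : F) + x.2.1 + x.2.2) ^ 3 = 27 * (x.1 * x.2.1 * x.2.2) then
        η x.2.1 * η⁻¹ x.2.2 else 0) -
          η x.2.1 * η⁻¹ x.2.2 * cubeRootCount (x.1 * x.2.1 * x.2.2) := by
      intro x
      simp only [ht, Units.val_mul]
      split_ifs <;> ring
    rw [h]
    simp_rw [h']
    rw [sum_sub_distrib, hX, ← mul_sum, sum_nodal_cone h2 h3 hω hη3]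
    ring
  have hreal : ∀ c e, (tripleSum η c e - t c e) ^ 2 =
      ((Complex.normSq (tripleSum η c e - t c e) : ℝ) : ℂ) := by
    intro c e
    have hs : star (tripleSum η c e - t c e) = tripleSum η c e - t c e := by
      rw [star_sub, star_tripleSum]
      simp only [ht, hq, cubeRootCount, star_sub, apply_ite star, star_sum, star_zero, star_one,
        star_natCast]
    rw [← Complex.mul_conj, starRingEnd_apply, hs, sq]
  have hzero : ∑ p : Fˣ × F, Complex.normSq (tripleSum η p.1 p.2 - t p.1 p.2) = 0 := by
    have h : ∑ c : Fˣ, ∑ e : F, (tripleSum η c e - t c e) ^ 2 = 0 := by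
      have h' : ∀ c e, (tripleSum η c e - t c e) ^ 2 =
          tripleSum η c e ^ 2 - 2 * (tripleSum η c e * t c e) + t c e ^ 2 := by
        intro c e; ring
      simp_rw [h', sum_add_distrib, sum_sub_distrib, ← mul_sum]
      rw [hWt, htt, sum_tripleSum_sq hψ hη hη2]
      ring
    simp_rw [hreal] at h
    rw [Fintype.sum_prod_type]
    exact_mod_cast h
  have := (sum_eq_zero_iff_of_nonneg fun p _ ↦ Complex.normSq_nonneg _).mp hzero (c, e)
    (mem_univ _)
  exact sub_eq_zero.mp (Complex.normSq_eq_zero.mp this)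

/-- The number of unit triples with product `1` and sum `e`, as a complex number. -/
noncomputable def tripleCount (e : F) : ℂ :=
  ∑ x : Fˣ × Fˣ × Fˣ, if x.1 * x.2.1 * x.2.2 = 1 ∧ (x.1 : F) + x.2.1 + x.2.2 = e then 1 else 0

lemma sum_hessian_units (a : F) :
    ∑ p : Fˣ × Fˣ, (if (p.1 : F) ^ 3 + p.2 ^ 3 + 1 = 3 * a * p.1 * p.2 then (1 : ℂ) else 0) =
      ∑ x : Fˣ × Fˣ × Fˣ, if x.1 * x.2.1 * x.2.2 = 1 ∧ (x.1 : F) + x.2.1 + x.2.2 = 3 * a then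
        cubeRootCount (x.2.1 * x.2.2⁻¹) else 0 := by
  have h : ∀ x : Fˣ × Fˣ × Fˣ,
      (if x.1 * x.2.1 * x.2.2 = 1 ∧ (x.1 : F) + x.2.1 + x.2.2 = 3 * a then
        cubeRootCount (x.2.1 * x.2.2⁻¹) else 0) =
      ∑ y : Fˣ, if (x.1 * x.2.1 * x.2.2 = 1 ∧ (x.1 : F) + x.2.1 + x.2.2 = 3 * a) ∧
        y ^ 3 = x.2.1 * x.2.2⁻¹ then 1 else 0 := by
    intro x
    split_ifs with hx
    · simp [cubeRootCount, hx]
    · simp [hx]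
  simp_rw [h]
  rw [← Fintype.sum_prod_type' (fun (x : Fˣ × Fˣ × Fˣ) (y : Fˣ) ↦
    if (x.1 * x.2.1 * x.2.2 = 1 ∧ (x.1 : F) + x.2.1 + x.2.2 = 3 * a) ∧
        y ^ 3 = x.2.1 * x.2.2⁻¹ then (1 : ℂ) else 0), ← sum_filter, ← sum_filter]
  refine sum_nbij' (fun p ↦ ((p.1 ^ 2 * p.2⁻¹, p.2 ^ 2 * p.1⁻¹, (p.1 * p.2)⁻¹), p.2))
    (fun z ↦ ((z.1.2.2 * z.2)⁻¹, z.2)) ?_ ?_ ?_ ?_ (fun _ _ ↦ rfl)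
  · rintro ⟨x, y⟩ hp
    simp only [mem_filter, mem_univ, true_and] at hp ⊢
    refine ⟨⟨?_, ?_⟩, ?_⟩
    · ext; push_cast; field_simp
    · push_cast
      field_simp
      linear_combination hp
    · ext; push_cast; field_simp
  · rintro ⟨⟨u, v, w⟩, y⟩ hz
    simp only [mem_filter, mem_univ, true_and] at hz ⊢
    obtain ⟨⟨h1, h2⟩, h3⟩ := hz
    have hv : (v : F) = w * y ^ 3 := by
      rw [eq_mul_inv_iff_mul_eq] at h3
      rw [← h3]; push_cast; ring
    have h1' : (u : F) * v * w = 1 := by simpa using congrArg Units.val h1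
    rw [hv] at h1' h2
    have hy := y.ne_zero
    have hw := w.ne_zero
    push_cast
    field_simp
    linear_combination (w : F) ^ 2 * y ^ 3 * h2 - h1'
  · rintro ⟨x, y⟩ _
    simp [mul_comm]
  · rintro ⟨⟨u, v, w⟩, y⟩ hz
    simp only [mem_filter, mem_univ, true_and] at hz
    obtain ⟨⟨h1, h2⟩, h3⟩ := hz
    rw [eq_mul_inv_iff_mul_eq] at h3
    subst h3
    have hu : u = (y ^ 3 * w * w)⁻¹ := eq_inv_of_mul_eq_one_left (by rw [← h1]; group)
    subst hu
    simp only [Prod.mk.injEq, and_true]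
    refine ⟨?_, ?_, ?_⟩ <;> (ext; push_cast; field_simp)

lemma sum_hessian_axis (h3 : (3 : F) ≠ 0) {ω : F} (hω : ω ^ 2 + ω + 1 = 0) :
    ∑ t : Fˣ, (if (t : F) ^ 3 + 1 = 0 then (1 : ℂ) else 0) = 3 := by
  rw [← cubeRootCount_pow_three h3 hω (-1), cubeRootCount]
  refine sum_congr rfl fun t _ ↦ if_congr ?_ rfl rfl
  rw [← Units.val_inj]
  push_cast
  rw [add_eq_zero_iff_eq_neg]
  norm_num

/-- The affine points of a nonsingular Hessian cubic are counted by `tripleCount`. -/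
lemma card_hessian {ψ : AddChar F ℂ} (hψ : ψ ≠ 1) (h2 : (2 : F) ≠ 0) (h3 : (3 : F) ≠ 0) {ω : F}
    (hω : ω ^ 2 + ω + 1 = 0) {η : MulChar F ℂ} (hη : η ≠ 1) (hη3 : η ^ 3 = 1) {a : F}
    (ha3 : a ^ 3 ≠ 1) :
    (Nat.card {xy : F × F // xy.1 ^ 3 + xy.2 ^ 3 + 1 = 3 * a * xy.1 * xy.2} : ℂ) =
      tripleCount (3 * a) := by
  have hN : (Nat.card {xy : F × F // xy.1 ^ 3 + xy.2 ^ 3 + 1 = 3 * a * xy.1 * xy.2} : ℂ) =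
      ∑ x : F, ∑ y : F, if x ^ 3 + y ^ 3 + 1 = 3 * a * x * y then (1 : ℂ) else 0 := by
    rw [← Fintype.sum_prod_type' (fun x y : F ↦
      if x ^ 3 + y ^ 3 + 1 = 3 * a * x * y then (1 : ℂ) else 0), Nat.card_eq_fintype_card,
      Fintype.card_subtype, sum_boole]
  have hW : ∀ {η : MulChar F ℂ}, η ≠ 1 → η ^ 3 = 1 → tripleSum η 1 (3 * a) = -3 := by
    intro η hη hη3
    have h1 : cubeRootCount (1 : Fˣ) = 3 := by
      simpa using cubeRootCount_pow_three h3 hω (1 : Fˣ)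
    have h27 : (27 : F) ≠ 0 := by
      rw [show (27 : F) = 3 ^ 3 by norm_num]
      exact pow_ne_zero 3 h3
    rw [tripleSum_eq hψ h2 h3 hω hη hη3, h1, if_neg, zero_sub]
    intro h
    apply ha3
    apply mul_left_cancel₀ h27
    rw [Units.val_one] at h
    linear_combination h
  have hterm : ∀ x : Fˣ × Fˣ × Fˣ,
      (if x.1 * x.2.1 * x.2.2 = 1 ∧ (x.1 : F) + x.2.1 + x.2.2 = 3 * a then
        cubeRootCount (x.2.1 * x.2.2⁻¹) else 0) =
      (if x.1 * x.2.1 * x.2.2 = 1 ∧ (x.1 : F) + x.2.1 + x.2.2 = 3 * a then 1 else 0) +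
      (if x.1 * x.2.1 * x.2.2 = 1 ∧ (x.1 : F) + x.2.1 + x.2.2 = 3 * a then
        η x.2.1 * η⁻¹ x.2.2 else 0) +
      (if x.1 * x.2.1 * x.2.2 = 1 ∧ (x.1 : F) + x.2.1 + x.2.2 = 3 * a then
        η⁻¹ x.2.1 * η⁻¹⁻¹ x.2.2 else 0) := by
    intro x
    split_ifs
    · rw [cubeRootCount_eq h3 hω hη hη3]
      simp only [Units.val_mul, map_mul, MulChar.inv_apply', Units.val_inv_eq_inv_val, inv_inv]
    · ring
  rw [hN, sum_field_eq_zero_add_units, sum_field_eq_zero_add_units]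
  simp_rw [sum_field_eq_zero_add_units (F := F) (fun y ↦ ite _ _ _)]
  rw [sum_add_distrib, ← Fintype.sum_prod_type' (fun x y : Fˣ ↦
    if (x : F) ^ 3 + (y : F) ^ 3 + 1 = 3 * a * x * y then (1 : ℂ) else 0), sum_hessian_units]
  simp_rw [hterm]
  rw [sum_add_distrib, sum_add_distrib]
  change _ + _ + (_ + (tripleCount (3 * a) + tripleSum η 1 (3 * a) +
    tripleSum η⁻¹ 1 (3 * a))) = _
  rw [hW hη hη3, hW (inv_ne_one.mpr hη) (by rw [inv_pow, hη3, inv_one])]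
  have hx := sum_hessian_axis h3 hω
  simp only [ne_eq, OfNat.ofNat_ne_zero, not_false_eq_true, zero_pow, zero_add, add_zero, mul_zero,
    zero_mul, one_ne_zero, if_false, hx]
  ring

lemma sum_mulChar_apply [Fintype (MulChar F ℂ)] (u : Fˣ) :
    ∑ χ : MulChar F ℂ, χ u = if u = 1 then (Fintype.card F : ℂ) - 1 else 0 := by
  have : NeZero (Monoid.exponent Fˣ : ℂ) :=
    ⟨Nat.cast_ne_zero.mpr Monoid.exponent_ne_zero_of_finite⟩
  split_ifs with hu
  · subst hu
    simp only [Units.val_one, map_one, sum_const, card_univ, nsmul_eq_mul, mul_one]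
    rw [← card_units_complex, ← Nat.card_eq_fintype_card,
      MulChar.card_eq_card_units_of_hasEnoughRootsOfUnity F ℂ, Nat.card_eq_fintype_card]
  · obtain ⟨χ, hχ⟩ := MulChar.exists_apply_ne_one_of_hasEnoughRootsOfUnity F ℂ
      (a := (u : F)) (by simpa using hu)
    refine eq_zero_of_mul_eq_self_left hχ ?_
    rw [mul_sum]
    exact Fintype.sum_equiv (Equiv.mulLeft χ) _ _ fun x ↦ by simp [MulChar.mul_apply]

lemma gaussSum_eq_sum_units (χ : MulChar F ℂ) (ψ : AddChar F ℂ) :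
    gaussSum χ ψ = ∑ u : Fˣ, χ u * ψ u := by
  rw [gaussSum, sum_field_eq_zero_add_units, MulChar.map_nonunit _ not_isUnit_zero, zero_mul,
    zero_add]

lemma sum_gaussSum_cube [Fintype (MulChar F ℂ)] {ψ : AddChar F ℂ} (hψ : ψ ≠ 1) (b : Fˣ) :
    ∑ χ : MulChar F ℂ, gaussSum χ⁻¹ ψ ^ 3 * gaussSum (χ ^ 3) ψ * (χ⁻¹ ^ 3) b =
      (Fintype.card F - 1) *
        (Fintype.card F * tripleCount (-b : F) - (Fintype.card F - 1) ^ 2) := by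
  have hterm : ∀ χ : MulChar F ℂ,
      gaussSum χ⁻¹ ψ ^ 3 * gaussSum (χ ^ 3) ψ * (χ⁻¹ ^ 3) b =
        ∑ k : Fˣ, ∑ x : Fˣ × Fˣ × Fˣ, χ ((x.1 * x.2.1 * x.2.2)⁻¹ : Fˣ) *
          ψ (k * ((x.1 : F) + x.2.1 + x.2.2 + b)) := by
    intro χ
    have hb : (χ⁻¹ ^ 3) b * (χ ^ 3) b = 1 := by
      rw [← MulChar.mul_apply, ← mul_pow, inv_mul_cancel, one_pow, MulChar.one_apply_coe]
    rw [← gaussSum_mulShift (χ ^ 3) ψ b, gaussSum_eq_sum_units (χ ^ 3)]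
    calc _ = ∑ k : Fˣ, gaussSum χ⁻¹ ψ ^ 3 * ((χ ^ 3) k * ψ (b * k)) := by
          rw [← mul_sum]
          simp only [AddChar.mulShift_apply]
          linear_combination gaussSum χ⁻¹ ψ ^ 3 * (∑ k : Fˣ, (χ ^ 3) k * ψ (b * k)) * hb
      _ = _ := by
          refine sum_congr rfl fun k _ ↦ ?_
          rw [← gaussSum_mulShift χ⁻¹ ψ k, gaussSum_eq_sum_units, mul_pow, ← MulChar.pow_apply_coe]
          have hk : (χ⁻¹ ^ 3) k * (χ ^ 3) k = 1 := by
            rw [← MulChar.mul_apply, ← mul_pow, inv_mul_cancel, one_pow, MulChar.one_apply_coe]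
          set S := ∑ u : Fˣ, χ⁻¹ u * (AddChar.mulShift ψ k) u with hS
          have : (χ⁻¹ ^ 3) k * S ^ 3 * ((χ ^ 3) k * ψ (b * k)) = S * S * S * ψ (b * k) := by
            linear_combination S ^ 3 * ψ (b * k) * hk
          rw [this, hS, sum_mul_sum, sum_mul]
          simp_rw [sum_mul, mul_sum, sum_mul, Fintype.sum_prod_type]
          refine sum_congr rfl fun u _ ↦ sum_congr rfl fun v _ ↦ sum_congr rfl fun w _ ↦ ?_
          simp only [AddChar.mulShift_apply, mul_add, AddChar.map_add_eq_mul, mul_inv,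
            Units.val_mul, map_mul, MulChar.inv_apply', Units.val_inv_eq_inv_val]
          rw [mul_comm (b : F)]
          ring
  simp_rw [hterm]
  rw [sum_comm]
  simp_rw [sum_comm (s := (univ : Finset (MulChar F ℂ))), ← sum_mul, sum_mulChar_apply, inv_eq_one]
  rw [sum_comm]
  simp_rw [← mul_sum, sum_units_addChar hψ, tripleCount]
  have hcount : ∑ x : Fˣ × Fˣ × Fˣ, (if x.1 * x.2.1 * x.2.2 = 1 then (1 : ℂ) else 0) =
      (Fintype.card F - 1) ^ 2 := by
    simp_rw [Fintype.sum_prod_type, mul_eq_one_iff_inv_eq]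
    simp only [sum_ite_eq, mem_univ, if_true, sum_const, card_univ, nsmul_eq_mul, mul_one,
      card_units_complex, sq]
  rw [mul_sub, ← mul_assoc, ← hcount, mul_sum, mul_sum, ← sum_sub_distrib]
  refine sum_congr rfl fun x _ ↦ ?_
  simp only [ite_and, add_eq_zero_iff_eq_neg]
  split_ifs <;> ring

lemma sum_pow_two_eq (h2 : (2 : F) ≠ 0) {φ : MulChar F ℂ} (hφ : φ ≠ 1) (hφ2 : φ ^ 2 = 1)
    (f : F → ℂ) : ∑ y : F, f (y ^ 2) = ∑ z : F, f z * (1 + φ z) := by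
  have hF : ringChar F ≠ 2 := fun h ↦ h2 <| by
    have := ringChar.Nat.cast_ringChar (R := F)
    rwa [h, Nat.cast_ofNat] at this
  have hquad : φ = (quadraticChar F).ringHomComp (Int.castRingHom ℂ) := by
    refine eq_of_sq_eq_one hφ hφ2 ?_ ?_
    · exact (MulChar.ringHomComp_ne_one_iff Int.cast_injective).mpr (quadraticChar_ne_one hF)
    · exact ((quadraticChar_isQuadratic F).comp _).sq_eq_one
  have hcard : ∀ z : F, (1 : ℂ) + φ z = ∑ y : F, if y ^ 2 = z then 1 else 0 := by
    intro z
    have := quadraticChar_card_sqrts hF z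
    rw [hquad, MulChar.ringHomComp_apply, sum_boole, add_comm, eq_intCast]
    have h1 : ((quadraticChar F z : ℤ) : ℂ) + 1 = ((quadraticChar F z + 1 : ℤ) : ℂ) := by
      push_cast; rfl
    rw [h1, ← this, Int.cast_natCast]
    congr 2
    ext y
    simp
  simp_rw [hcard, mul_sum]
  rw [sum_comm]
  simp

lemma jacobiSum_self (h2 : (2 : F) ≠ 0) {φ : MulChar F ℂ} (hφ : φ ≠ 1) (hφ2 : φ ^ 2 = 1)
    {χ : MulChar F ℂ} (hχ : χ ≠ 1) : χ 4 * jacobiSum χ χ = jacobiSum φ χ := by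
  have h4 : (4 : F) = 2 * 2 := by norm_num
  have h : χ 4 * jacobiSum χ χ = ∑ y : F, χ (1 - y ^ 2) := by
    rw [jacobiSum, mul_sum]
    refine Fintype.sum_equiv ((Equiv.mulLeft₀ 2 h2).trans (Equiv.subRight 1)) _ _ fun x ↦ ?_
    rw [← map_mul, ← map_mul]
    congr 1
    simp only [Equiv.trans_apply, Equiv.mulLeft₀_apply, Equiv.subRight_apply]
    ring
  have h0 : ∑ z : F, χ (1 - z) = 0 := by
    rw [Fintype.sum_equiv (Equiv.subLeft 1) (fun z ↦ χ (1 - z)) χ fun x ↦ rfl]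
    exact MulChar.sum_eq_zero_of_ne_one hχ
  rw [h, sum_pow_two_eq h2 hφ hφ2 (fun z ↦ χ (1 - z)), jacobiSum]
  simp_rw [mul_add, mul_one, sum_add_distrib, h0, zero_add, mul_comm]

/-- The quadratic Hasse–Davenport relation. -/
lemma gaussSum_mul_gaussSum_quadratic {ψ : AddChar F ℂ} (hψ : ψ ≠ 1) (h2 : (2 : F) ≠ 0)
    {φ : MulChar F ℂ} (hφ : φ ≠ 1) (hφ2 : φ ^ 2 = 1) (χ : MulChar F ℂ) :
    χ 4 * (gaussSum χ ψ * gaussSum (φ * χ) ψ) = gaussSum φ ψ * gaussSum (χ ^ 2) ψ := by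
  have h4 : (4 : F) = 2 * 2 := by norm_num
  have hψ' := AddChar.IsPrimitive.of_ne_one hψ
  by_cases hχ1 : χ = 1
  · subst hχ1
    rw [mul_one, one_pow, h4, MulChar.one_apply (h2.isUnit.mul h2.isUnit)]
    ring
  by_cases hχφ : χ = φ
  · subst hχφ
    rw [← sq, hφ2, h4, map_mul, ← sq, ← MulChar.pow_apply' _ two_ne_zero, hφ2,
      MulChar.one_apply h2.isUnit]
    ring
  have hχ2 : χ * χ ≠ 1 := fun h ↦ hχφ (eq_of_sq_eq_one hχ1 (by rw [sq, h]) hφ hφ2)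
  have hφχ : φ * χ ≠ 1 := by
    intro h
    apply hχφ
    rw [← mul_left_cancel_iff (a := φ), h, ← sq, hφ2]
  have e1 := jacobiSum_mul_nontrivial hχ2 ψ
  have e2 := jacobiSum_mul_nontrivial hφχ ψ
  rw [← jacobiSum_self h2 hφ hφ2 hχ1] at e2
  have hG := gaussSum_ne_zero_of_nontrivial (by simp : (Fintype.card F : ℂ) ≠ 0) hχ1 hψ'
  apply mul_right_cancel₀ hG
  rw [sq χ]
  linear_combination gaussSum (χ * χ) ψ * e2 - χ 4 * gaussSum (φ * χ) ψ * e1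

lemma gaussSum_quotient_eq {ψ : AddChar F ℂ} (hψ : ψ ≠ 1) (h2 : (2 : F) ≠ 0) {φ : MulChar F ℂ}
    (hφ : φ ≠ 1) (hφ2 : φ ^ 2 = 1) (χ : MulChar F ℂ) (c : Fˣ) :
    (Fintype.card F : ℂ) ^ 2 * φ c * (gaussSum (χ⁻¹ ^ 2) ψ ^ 3 * gaussSum ((χ ^ 3) ^ 2) ψ /
        (gaussSum χ⁻¹ ψ ^ 3 * gaussSum (χ ^ 3) ψ) * (χ⁻¹ ^ 3) c) =
      gaussSum (φ * χ)⁻¹ ψ ^ 3 * gaussSum ((φ * χ) ^ 3) ψ * ((φ * χ)⁻¹ ^ 3) c := by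
  have hinv : φ⁻¹ = φ := inv_eq_of_mul_eq_one_right (by rw [← sq, hφ2])
  have hφ3 : φ ^ 3 = φ := by rw [pow_succ, hφ2, one_mul]
  have e1 := gaussSum_mul_gaussSum_quadratic hψ h2 hφ hφ2 χ⁻¹
  have e2 := gaussSum_mul_gaussSum_quadratic hψ h2 hφ hφ2 (χ ^ 3)
  have hA := gaussSum_ne_zero_complex hψ χ⁻¹
  have hB := gaussSum_ne_zero_complex hψ (χ ^ 3)
  have h4 : (χ⁻¹ 4) ^ 3 * (χ ^ 3) 4 = 1 := by
    have h4 : (4 : F) = (Units.mk0 2 h2 ^ 2 : Fˣ) := by norm_num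
    rw [h4, ← MulChar.pow_apply_coe, ← MulChar.mul_apply, ← mul_pow, inv_mul_cancel, one_pow,
      MulChar.one_apply_coe]
  rw [mul_inv, mul_pow, mul_pow, hinv, hφ3, MulChar.mul_apply,
    ← gaussSum_quadratic_pow_four hψ hφ hφ2]
  field_simp
  have e3 : gaussSum φ ψ ^ 4 * (gaussSum (χ⁻¹ ^ 2) ψ ^ 3 * gaussSum ((χ ^ 3) ^ 2) ψ) =
      gaussSum χ⁻¹ ψ ^ 3 * gaussSum (χ ^ 3) ψ * (gaussSum (φ * χ⁻¹) ψ ^ 3 *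
        gaussSum (φ * χ ^ 3) ψ) := by
    calc _ = (gaussSum φ ψ * gaussSum (χ⁻¹ ^ 2) ψ) ^ 3 *
          (gaussSum φ ψ * gaussSum ((χ ^ 3) ^ 2) ψ) := by ring
      _ = _ := by
        rw [← e1, ← e2]
        linear_combination gaussSum χ⁻¹ ψ ^ 3 * gaussSum (χ ^ 3) ψ * (gaussSum (φ * χ⁻¹) ψ ^ 3 *
          gaussSum (φ * χ ^ 3) ψ) * h4
  linear_combination φ c * (χ⁻¹ ^ 3) c * e3

lemma sum_gaussSum_quotient [Fintype (MulChar F ℂ)] [DecidableEq (MulChar F ℂ)]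
    {ψ : AddChar F ℂ} (hψ : ψ ≠ 1) (h2 : (2 : F) ≠ 0)
    {φ : MulChar F ℂ} (hφ : φ ≠ 1) (hφ2 : φ ^ 2 = 1) (c : Fˣ) :
    (Fintype.card F : ℂ) ^ 2 * φ c * ∑ χ ∈ univ.erase φ,
      (gaussSum (χ⁻¹ ^ 2) ψ ^ 3 * gaussSum ((χ ^ 3) ^ 2) ψ /
        (gaussSum χ⁻¹ ψ ^ 3 * gaussSum (χ ^ 3) ψ) * (χ⁻¹ ^ 3) c) =
      (Fintype.card F - 1) *
        (Fintype.card F * tripleCount (-c : F) - (Fintype.card F - 1) ^ 2) - 1 := by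
  rw [mul_sum]
  simp_rw [gaussSum_quotient_eq hψ h2 hφ hφ2]
  rw [sum_erase_eq_sub (mem_univ φ), ← sum_gaussSum_cube hψ]
  congr 1
  · exact Fintype.sum_equiv (Equiv.mulLeft φ) _ _ fun χ ↦ rfl
  · rw [← sq, hφ2, inv_one, one_pow, gaussSum_one_left hψ, MulChar.one_apply_coe]
    norm_num

/-- The generator of a cyclic group indexes it by exponents below its order. -/
lemma sum_erase_pow_eq {G : Type*} [CommGroup G] [Fintype G] [DecidableEq G] {M : Type*}
    [AddCommMonoid M] {T : G}
    (hT : ∀ g : G, g ∈ Subgroup.zpowers T) {m : ℕ} (hm : m < Fintype.card G) (f : G → M) :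
    ∑ l ∈ (range (Fintype.card G)).filter (fun l ↦ l ≠ m), f (T ^ l) =
      ∑ g ∈ univ.erase (T ^ m), f g := by
  have hord : orderOf T = Fintype.card G := by
    rw [orderOf_eq_card_of_forall_mem_zpowers hT, Nat.card_eq_fintype_card]
  have hinj : Set.InjOn (fun l : ℕ ↦ T ^ l) (Set.Iio (orderOf T)) := pow_injOn_Iio_orderOf
  rw [hord] at hinj
  refine sum_bij (fun l _ ↦ T ^ l) ?_ ?_ ?_ (fun _ _ ↦ rfl)
  · intro l hl
    simp only [mem_filter, mem_range] at hl
    exact mem_erase.mpr ⟨fun h ↦ hl.2 (hinj hl.1 hm h), mem_univ _⟩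
  · intro l hl k hk h
    simp only [mem_filter, mem_range] at hl hk
    exact hinj hl.1 hk.1 h
  · intro g hg
    obtain ⟨k, rfl⟩ := mem_powers_iff_mem_zpowers.mpr (hT g)
    refine ⟨k % Fintype.card G, ?_, ?_⟩
    · simp only [mem_filter, mem_range]
      refine ⟨Nat.mod_lt _ Fintype.card_pos, fun h ↦ (mem_erase.mp hg).1 ?_⟩
      rw [← h, ← hord, pow_mod_orderOf]
    · rw [← hord]
      exact pow_mod_orderOf T k

lemma exists_cube_root_of_unity (h3 : (Fintype.card F) % 3 = 1) :
    ∃ ω : F, ω ^ 2 + ω + 1 = 0 := by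
  obtain ⟨g, hg⟩ := IsCyclic.exists_generator (α := Fˣ)
  have hord : orderOf g = Fintype.card F - 1 := by
    rw [orderOf_eq_card_of_forall_mem_zpowers hg, Nat.card_eq_fintype_card, Fintype.card_units]
  have hcard := Fintype.one_lt_card (α := F)
  have hne : g ^ ((Fintype.card F - 1) / 3) ≠ 1 :=
    pow_ne_one_of_lt_orderOf (by omega) (by omega)
  have h1 : (g ^ ((Fintype.card F - 1) / 3)) ^ 3 = 1 := by
    rw [← pow_mul, Nat.div_mul_cancel (by omega), ← hord, pow_orderOf_eq_one]
  refine ⟨(g ^ ((Fintype.card F - 1) / 3) : Fˣ), ?_⟩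
  set w := g ^ ((Fintype.card F - 1) / 3)
  have h1' : (w : F) ^ 3 = 1 := by rw [← Units.val_pow_eq_pow_val, h1, Units.val_one]
  have hne' : (w : F) - 1 ≠ 0 := sub_ne_zero.mpr fun h ↦ hne (Units.val_eq_one.mp h)
  apply mul_left_cancel₀ hne'
  linear_combination h1'

end Counting

end HessianPointCount

open HessianPointCount

/-- For `p > 5`, `q ≡ 1 (mod 3)` and `a ∈ F_q^×` with `a³ ≠ 1`, the number of affine
`F_q`-points of the Hessian curve `x³ + y³ + 1 = 3axy` satisfies
`q·#C_a(F_q) = q² + 4q + 1 + 1/(q−1) − 6q·φ(−3)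
  + (q²·φ(−3a)/(q−1)) Σ_{l=0, l≠(q−1)/2}^{q−2} [G_{−2l}³ G_{6l}/(G_{−l}³ G_{3l})] T^{−3l}(−3a)`,
where `φ = T^{(q−1)/2}` is the quadratic character. -/
theorem hessian_point_count_three_dvd
    (p r : ℕ) (hp : p.Prime) (hp5 : 5 < p) (hr : 0 < r)
    (F : Type) [Field F] [Fintype F] (hcard : Fintype.card F = p ^ r)
    (ψ : AddChar F ℂ) (hψ : ψ ≠ 1)
    (T : MulChar F ℂ) (hT : ∀ χ : MulChar F ℂ, χ ∈ Subgroup.zpowers T)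
    (hq3 : p ^ r % 3 = 1)
    (a : F) (ha : a ≠ 0) (ha3 : a ^ 3 ≠ 1) :
    (p : ℂ) ^ r *
        (Nat.card {xy : F × F // xy.1 ^ 3 + xy.2 ^ 3 + 1 = 3 * a * xy.1 * xy.2} : ℂ)
      = ((p : ℂ) ^ r) ^ 2 + 4 * (p : ℂ) ^ r + 1 + 1 / ((p : ℂ) ^ r - 1)
        - 6 * (p : ℂ) ^ r * (T ^ ((p ^ r - 1) / 2)) (-3 : F)
        + ((p : ℂ) ^ r) ^ 2 * (T ^ ((p ^ r - 1) / 2)) (-3 * a) / ((p : ℂ) ^ r - 1) *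
          ∑ l ∈ (Finset.range (p ^ r - 1)).filter (fun l => l ≠ (p ^ r - 1) / 2),
            ((gaussSum (T ^ (-(2 * (l : ℤ)))) ψ) ^ 3 * gaussSum (T ^ (6 * (l : ℤ))) ψ /
                ((gaussSum (T ^ (-(l : ℤ))) ψ) ^ 3 * gaussSum (T ^ (3 * (l : ℤ))) ψ)) *
              (T ^ (-(3 * (l : ℤ)))) (-3 * a) := by
  classical
  let _ : Fintype (MulChar F ℂ) := Fintype.ofFinite _
  have hn3 : Fintype.card F % 3 = 1 := by rw [hcard, hq3]
  have hcardG : Fintype.card (MulChar F ℂ) = Fintype.card F - 1 := by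
    have : NeZero (Monoid.exponent Fˣ : ℂ) :=
      ⟨Nat.cast_ne_zero.mpr Monoid.exponent_ne_zero_of_finite⟩
    rw [← Nat.card_eq_fintype_card, MulChar.card_eq_card_units_of_hasEnoughRootsOfUnity F ℂ,
      Nat.card_eq_fintype_card, Fintype.card_units]
  have hodd : Fintype.card F % 2 = 1 := by
    rw [hcard]
    exact Nat.odd_iff.mp ((hp.odd_of_ne_two (by omega)).pow)
  have hone := Fintype.one_lt_card (α := F)
  have hord : orderOf T = Fintype.card F - 1 := by
    rw [orderOf_eq_card_of_forall_mem_zpowers hT, Nat.card_eq_fintype_card, hcardG]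
  have h2 : (2 : F) ≠ 0 := by
    exact_mod_cast natCast_ne_zero_of_lt (n := 2) hp hcard (by omega) (by omega)
  have h3 : (3 : F) ≠ 0 := by
    exact_mod_cast natCast_ne_zero_of_lt (n := 3) hp hcard (by omega) (by omega)
  obtain ⟨ω, hω⟩ := exists_cube_root_of_unity hn3
  have hpr : (p : ℂ) ^ r = (Fintype.card F : ℂ) := by rw [hcard, Nat.cast_pow]
  rw [hpr, ← hcard]
  have hroot : ∀ d, 1 < d → (Fintype.card F - 1) % d = 0 →
      T ^ ((Fintype.card F - 1) / d) ≠ 1 ∧ (T ^ ((Fintype.card F - 1) / d)) ^ d = 1 := by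
    intro d hd hdvd
    refine ⟨pow_ne_one_of_lt_orderOf ?_ ?_, ?_⟩
    · exact (Nat.div_pos (Nat.le_of_dvd (by omega) (Nat.dvd_of_mod_eq_zero hdvd)) (by omega)).ne'
    · rw [hord]
      exact Nat.div_lt_self (by omega) hd
    · rw [← pow_mul, Nat.div_mul_cancel (Nat.dvd_of_mod_eq_zero hdvd), ← hord, pow_orderOf_eq_one]
  obtain ⟨hφ, hφ2⟩ := hroot 2 (by omega) (by omega)
  obtain ⟨hη, hη3⟩ := hroot 3 (by omega) (by omega)
  rw [card_hessian hψ h2 h3 hω hη hη3 ha3]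
  have hsum := sum_erase_pow_eq hT (m := (Fintype.card F - 1) / 2) (by omega)
    (fun χ ↦ gaussSum (χ⁻¹ ^ 2) ψ ^ 3 * gaussSum ((χ ^ 3) ^ 2) ψ /
        (gaussSum χ⁻¹ ψ ^ 3 * gaussSum (χ ^ 3) ψ) * (χ⁻¹ ^ 3) (-3 * a))
  rw [hcardG] at hsum
  have hexp : ∀ l : ℕ, T ^ (-(2 * (l : ℤ))) = (T ^ l)⁻¹ ^ 2 ∧
      T ^ (6 * (l : ℤ)) = ((T ^ l) ^ 3) ^ 2 ∧ T ^ (-(l : ℤ)) = (T ^ l)⁻¹ ∧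
      T ^ (3 * (l : ℤ)) = (T ^ l) ^ 3 ∧ T ^ (-(3 * (l : ℤ))) = (T ^ l)⁻¹ ^ 3 := by
    intro l
    simp only [← zpow_natCast, ← zpow_neg, ← zpow_mul]
    refine ⟨?_, ?_, trivial, ?_, ?_⟩ <;> congr 1 <;> push_cast <;> ring
  have hsum' := sum_congr rfl fun l (_ : l ∈ (range (Fintype.card F - 1)).filter
      fun l ↦ l ≠ (Fintype.card F - 1) / 2) ↦ (show
      ((gaussSum (T ^ (-(2 * (l : ℤ)))) ψ) ^ 3 * gaussSum (T ^ (6 * (l : ℤ))) ψ /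
                ((gaussSum (T ^ (-(l : ℤ))) ψ) ^ 3 * gaussSum (T ^ (3 * (l : ℤ))) ψ)) *
              (T ^ (-(3 * (l : ℤ)))) (-3 * a) = _ by
        obtain ⟨e1, e2, e3, e4, e5⟩ := hexp l
        rw [e1, e2, e3, e4, e5])
  rw [hsum', hsum]
  set φ := T ^ ((Fintype.card F - 1) / 2) with hφdef
  have hc : -3 * a ≠ 0 := mul_ne_zero (neg_ne_zero.mpr h3) ha
  have key := sum_gaussSum_quotient hψ h2 hφ hφ2 (Units.mk0 (-3 * a) hc)
  rw [Units.val_mk0, show -(-3 * a) = 3 * a by ring] at key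
  have hφ3 : φ (-3) = 1 := by
    have hs : (-3 : F) = (2 * ω + 1) ^ 2 := by linear_combination -4 * hω
    have hne : 2 * ω + 1 ≠ 0 := fun h ↦ neg_ne_zero.mpr h3 (by rw [hs, h, zero_pow two_ne_zero])
    rw [hs, map_pow, ← MulChar.pow_apply' _ two_ne_zero, hφ2, MulChar.one_apply hne.isUnit]
  have hq1 : (Fintype.card F : ℂ) - 1 ≠ 0 := by
    rw [← card_units_complex]
    exact Nat.cast_ne_zero.mpr Fintype.card_ne_zero
  rw [div_mul_eq_mul_div, key, hφ3]
  field_simp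
  ring
end

section
/- Let p > 5 be a prime, q = p^r with q ≢ 1 (mod 3), and let a ∈ F_q^× with a³ ≠ 1. Then the number of affine F_q-points of the Hessian curve C_a satisfies q · #C_a(F_q) = q² + 1 + (1/(q−1)) Σ_{l=0}^{q−2} G_{−l}³ G_{3l} T^{−3l}(−3a), as an identity of complex numbers (indices of G and exponents of T are taken modulo q−1). -/
theorem sum_eq_zero_add_sum_units {F M : Type*} [Field F] [Fintype F] [DecidableEq F] [AddCommMonoid M]
    (f : F → M) : ∑ x, f x = f 0 + ∑ u : Fˣ, f u := by
  rw [← Finset.add_sum_erase _ _ (Finset.mem_univ (0 : F))]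
  congr 1
  symm
  refine Finset.sum_bij (fun u _ => (u : F)) (fun u _ => by simp) (fun u _ v _ h => Units.ext h)
    (fun x hx => ⟨Units.mk0 x (by simpa using hx), by simp, rfl⟩) (fun _ _ => rfl)

theorem gaussSum_eq_sum_units {F R : Type*} [Field F] [Fintype F] [DecidableEq F] [CommRing R]
    (χ : MulChar F R) (ψ : AddChar F R) :
    gaussSum χ ψ = ∑ u : Fˣ, χ u * ψ u := by
  rw [gaussSum, sum_eq_zero_add_sum_units, MulChar.map_zero, zero_mul, zero_add]

theorem MulChar.zpow_apply_coe_units {F R : Type*} [Field F] [Field R]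
    (χ : MulChar F R) (n : ℤ) (u : Fˣ) : (χ ^ n) (u : F) = χ u ^ n := by
  have h := map_zpow (MulChar.mulEquivToUnitHom (R := F) (R' := R)) χ n
  have h1 := congrArg (fun φ : Fˣ →* Rˣ => ((φ u : Rˣ) : R)) h
  simpa [MulChar.coe_toUnitHom, MulChar.mulEquivToUnitHom] using h1

open Finset in
/-- Orthogonality for the powers of a generator of the character group. -/
theorem MulChar.sum_generator_pow {F : Type*} [Field F] [Fintype F] [DecidableEq F]
    (T : MulChar F ℂ) (hT : ∀ χ : MulChar F ℂ, χ ∈ Subgroup.zpowers T) (b : Fˣ) :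
    ∑ l ∈ range (Fintype.card F - 1), T b ^ l =
      if b = 1 then ((Fintype.card F : ℂ) - 1) else 0 := by
  split_ifs with hb
  · simp [hb, Nat.cast_sub Fintype.card_pos]
  · have hne : T b ≠ 1 := by
      intro h1
      have hb1 : (b : F) ≠ 1 := by simpa using hb
      obtain ⟨χ, hχ⟩ := MulChar.exists_apply_ne_one_of_hasEnoughRootsOfUnity F ℂ hb1
      obtain ⟨n, rfl⟩ := hT χ
      apply hχ
      change (T ^ n) (b : F) = 1
      rw [MulChar.zpow_apply_coe_units, h1, one_zpow]
    rw [geom_sum_eq hne, ← map_pow, FiniteField.pow_card_sub_one_eq_one _ b.ne_zero]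
    simp

open Finset in
theorem sum_gaussSum_cube_mul {F : Type*} [Field F] [Fintype F] [DecidableEq F]
    (ψ : AddChar F ℂ) (T : MulChar F ℂ) (hT : ∀ χ : MulChar F ℂ, χ ∈ Subgroup.zpowers T)
    (hcube : Function.Bijective fun x : Fˣ => x ^ 3) (c : Fˣ) :
    ∑ l ∈ range (Fintype.card F - 1),
        gaussSum (T ^ (-(l : ℤ))) ψ ^ 3 * gaussSum (T ^ (3 * (l : ℤ))) ψ *
          (T ^ (-(3 * (l : ℤ)))) (c : F) =
      ((Fintype.card F : ℂ) - 1) * ∑ x : Fˣ, ∑ y : Fˣ, ∑ z : Fˣ,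
        ψ ((z : F) * ((x : F) ^ 3 + (y : F) ^ 3 + 1 + c * x * y)) := by
  have hne (u : Fˣ) : T (u : F) ≠ 0 := (u.isUnit.map T).ne_zero
  have expand (l : ℕ) : gaussSum (T ^ (-(l : ℤ))) ψ ^ 3 * gaussSum (T ^ (3 * (l : ℤ))) ψ *
      (T ^ (-(3 * (l : ℤ)))) (c : F) =
      ∑ w : Fˣ, ∑ u : Fˣ, ∑ v : Fˣ, ∑ t : Fˣ,
        ψ ((w : F) + u + v + t) * T ((t ^ 3 / (u * v * w * c ^ 3) : Fˣ) : F) ^ l := by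
    have factor (w u v t : Fˣ) :
        ψ ((w : F) + u + v + t) * T ((t ^ 3 / (u * v * w * c ^ 3) : Fˣ) : F) ^ l =
        (T ^ (-(l : ℤ))) (w : F) * ψ w * ((T ^ (-(l : ℤ))) (u : F) * ψ u *
          ((T ^ (-(l : ℤ))) (v : F) * ψ v * ((T ^ (3 * (l : ℤ))) (t : F) * ψ t *
            (T ^ (-(3 * (l : ℤ)))) (c : F)))) := by
      have hT3 (x : Fˣ) : T (x : F) ^ (3 * (l : ℤ)) = (T (x : F) ^ l) ^ 3 := by
        rw [mul_comm, zpow_mul, zpow_natCast]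
        norm_cast
      have hdiv : T ((t ^ 3 / (u * v * w * c ^ 3) : Fˣ) : F) =
          T t ^ 3 / (T u * T v * T w * T c ^ 3) := by
        rw [Units.val_div_eq_div_val, eq_div_iff
          (by simp [hne]), ← map_pow, ← map_pow, ← map_mul, ← map_mul, ← map_mul, ← map_mul]
        congr 1
        push_cast
        field_simp
      simp only [MulChar.zpow_apply_coe_units]
      simp only [zpow_neg, hT3, zpow_natCast, hdiv,
        AddChar.map_add_eq_mul, div_pow, mul_pow]
      have hu := hne u
      have hv := hne v
      have hw := hne w
      have hc := hne c
      field_simp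
      ring
    simp only [factor, ← Finset.mul_sum, ← Finset.sum_mul]
    simp only [gaussSum_eq_sum_units]
    ring
  have scale (w : Fˣ) (f : Fˣ → ℂ) : ∑ u, f u = ∑ x : Fˣ, f (w * x ^ 3) := by
    rw [← Equiv.sum_comp (Equiv.mulLeft w) f]
    exact (hcube.sum_comp fun x => f (w * x)).symm
  have inner (w x y : Fˣ) : ∑ t : Fˣ, ψ ((w : F) + (w * x ^ 3 : Fˣ) + (w * y ^ 3 : Fˣ) + t) *
      (if t ^ 3 / (w * x ^ 3 * (w * y ^ 3) * w * c ^ 3) = 1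
        then ((Fintype.card F : ℂ) - 1) else 0) =
      ((Fintype.card F : ℂ) - 1) *
        ψ ((w : F) * ((x : F) ^ 3 + (y : F) ^ 3 + 1 + c * x * y)) := by
    have hiff (t : Fˣ) : t ^ 3 / (w * x ^ 3 * (w * y ^ 3) * w * c ^ 3) = 1 ↔
        t = c * w * x * y := by
      have : w * x ^ 3 * (w * y ^ 3) * w * c ^ 3 = (c * w * x * y) ^ 3 := by
        simp only [pow_succ, pow_zero, one_mul]
        ac_rfl
      rw [div_eq_one, this]
      exact hcube.injective.eq_iff
    simp only [hiff, mul_ite, mul_zero, Finset.sum_ite_eq', Finset.mem_univ, if_true]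
    rw [mul_comm]
    congr 2
    push_cast
    ring
  simp only [expand]
  rw [Finset.sum_comm]
  calc _ = ∑ w : Fˣ, ∑ u : Fˣ, ∑ v : Fˣ, ∑ t : Fˣ, ψ ((w : F) + u + v + t) *
        (if t ^ 3 / (u * v * w * c ^ 3) = 1 then ((Fintype.card F : ℂ) - 1) else 0) := by
        simp only [← MulChar.sum_generator_pow T hT, Finset.mul_sum]
        refine Finset.sum_congr rfl fun w _ => ?_
        rw [Finset.sum_comm]
        refine Finset.sum_congr rfl fun u _ => ?_
        rw [Finset.sum_comm]
        refine Finset.sum_congr rfl fun v _ => ?_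
        rw [Finset.sum_comm]
    _ = ∑ w : Fˣ, ∑ x : Fˣ, ∑ y : Fˣ, ((Fintype.card F : ℂ) - 1) *
        ψ ((w : F) * ((x : F) ^ 3 + (y : F) ^ 3 + 1 + c * x * y)) := by
        refine Finset.sum_congr rfl fun w _ => ?_
        rw [scale w]
        refine Finset.sum_congr rfl fun x _ => ?_
        rw [scale w]
        refine Finset.sum_congr rfl fun y _ => ?_
        exact inner w x y
    _ = _ := by
        simp only [← Finset.mul_sum]
        rw [Finset.sum_comm]
        congr 1
        refine Finset.sum_congr rfl fun x _ => ?_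
        rw [Finset.sum_comm]

open Finset in
theorem card_mul_card_hessian {F : Type*} [Field F] [Fintype F] [DecidableEq F]
    (ψ : AddChar F ℂ) (hψ : ψ ≠ 1) (hcube : Function.Bijective fun x : Fˣ => x ^ 3) (a : F) :
    (Fintype.card F : ℂ) *
        (Nat.card {xy : F × F // xy.1 ^ 3 + xy.2 ^ 3 + 1 = 3 * a * xy.1 * xy.2} : ℂ) =
      (Fintype.card F : ℂ) ^ 2 + 1 + ∑ x : Fˣ, ∑ y : Fˣ, ∑ z : Fˣ,
        ψ ((z : F) * ((x : F) ^ 3 + (y : F) ^ 3 + 1 + -3 * a * x * y)) := by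
  have hprim : ψ.IsPrimitive := AddChar.IsPrimitive.of_ne_one hψ
  have orth (b : F) : ∑ z, ψ (z * b) = if b = 0 then (Fintype.card F : ℂ) else 0 := by
    rw [AddChar.sum_mulShift b hprim]
    split_ifs <;> simp
  have root (u : Fˣ) : (u : F) ^ 3 + 1 = 0 ↔ u = -1 := by
    rw [← hcube.injective.eq_iff, Units.ext_iff]
    push_cast
    rw [Odd.neg_one_pow (by decide), eq_neg_iff_add_eq_zero]
  have total : (Fintype.card F : ℂ) *
        (Nat.card {xy : F × F // xy.1 ^ 3 + xy.2 ^ 3 + 1 = 3 * a * xy.1 * xy.2} : ℂ) =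
      ∑ x : F, ∑ y : F, ∑ z : F, ψ (z * (x ^ 3 + y ^ 3 + 1 + -3 * a * x * y)) := by
    simp only [orth]
    rw [← Fintype.sum_prod_type'
      (f := fun x y : F => if x ^ 3 + y ^ 3 + 1 + -3 * a * x * y = 0 then
        (Fintype.card F : ℂ) else 0), Nat.card_eq_fintype_card, Fintype.card_subtype,
      ← Finset.sum_filter, Finset.sum_const, nsmul_eq_mul, mul_comm]
    congr 3
    ext xy
    simp only [Finset.mem_filter, Finset.mem_univ, true_and]
    rw [← sub_eq_zero]
    ring_nf
  have hzero (x : F) : ∑ z : F, ψ (z * x) = 1 + ∑ z : Fˣ, ψ (z * x) := by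
    rw [sum_eq_zero_add_sum_units]
    simp
  have hunits : (Fintype.card Fˣ : ℂ) = (Fintype.card F : ℂ) - 1 := by
    rw [Fintype.card_units, Nat.cast_sub Fintype.card_pos, Nat.cast_one]
  have hline : ∑ y : Fˣ, ∑ z : F, ψ (z * ((y : F) ^ 3 + 1)) = Fintype.card F := by
    simp [orth, root]
  rw [total, sum_eq_zero_add_sum_units]
  have hx0 : ∑ y : F, ∑ z : F, ψ (z * ((0 : F) ^ 3 + y ^ 3 + 1 + -3 * a * 0 * y)) =
      Fintype.card F := by
    rw [sum_eq_zero_add_sum_units, ← hline]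
    simp [orth, AddChar.sum_eq_zero_of_ne_one hψ]
  have hx (x : Fˣ) : ∑ y : F, ∑ z : F, ψ (z * ((x : F) ^ 3 + y ^ 3 + 1 + -3 * a * x * y)) =
      ∑ z : F, ψ (z * ((x : F) ^ 3 + 1)) + (((Fintype.card F : ℂ) - 1) + ∑ y : Fˣ, ∑ z : Fˣ,
        ψ ((z : F) * ((x : F) ^ 3 + (y : F) ^ 3 + 1 + -3 * a * x * y))) := by
    rw [sum_eq_zero_add_sum_units]
    congr 1
    · simp
    · simp only [hzero, Finset.sum_add_distrib, Finset.sum_const, Finset.card_univ, nsmul_eq_mul,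
        hunits, mul_one]
  rw [hx0]
  simp only [hx, Finset.sum_add_distrib, hline, Finset.sum_const, Finset.card_univ, nsmul_eq_mul,
    hunits]
  ring


/-- For `p > 5`, `q ≢ 1 (mod 3)` and `a ∈ F_q^×` with `a³ ≠ 1`, the number of affine
`F_q`-points of the Hessian curve `x³ + y³ + 1 = 3axy` satisfies
`q·#C_a(F_q) = q² + 1 + (1/(q−1)) Σ_{l=0}^{q−2} G_{−l}³ G_{3l} T^{−3l}(−3a)`. -/
theorem hessian_point_count_three_not_dvd
    (p r : ℕ) (hp : p.Prime) (hp5 : 5 < p) (hr : 0 < r)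
    (F : Type) [Field F] [Fintype F] (hcard : Fintype.card F = p ^ r)
    (ψ : AddChar F ℂ) (hψ : ψ ≠ 1)
    (T : MulChar F ℂ) (hT : ∀ χ : MulChar F ℂ, χ ∈ Subgroup.zpowers T)
    (hq3 : p ^ r % 3 ≠ 1)
    (a : F) (ha : a ≠ 0) (ha3 : a ^ 3 ≠ 1) :
    (p : ℂ) ^ r *
        (Nat.card {xy : F × F // xy.1 ^ 3 + xy.2 ^ 3 + 1 = 3 * a * xy.1 * xy.2} : ℂ)
      = ((p : ℂ) ^ r) ^ 2 + 1
        + (1 / ((p : ℂ) ^ r - 1)) *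
          ∑ l ∈ Finset.range (p ^ r - 1),
            (gaussSum (T ^ (-(l : ℤ))) ψ) ^ 3 * gaussSum (T ^ (3 * (l : ℤ))) ψ *
              (T ^ (-(3 * (l : ℤ)))) (-3 * a) := by
  classical
  have hcop : (Nat.card Fˣ).Coprime 3 := by
    rw [Nat.card_eq_fintype_card, Fintype.card_units, hcard, Nat.coprime_comm,
      Nat.Prime.coprime_iff_not_dvd Nat.prime_three]
    have h3 : ¬ 3 ∣ p ^ r := fun h => by
      have := (Nat.prime_dvd_prime_iff_eq Nat.prime_three hp).1
        (Nat.prime_three.dvd_of_dvd_pow h)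
      omega
    omega
  have hcube : Function.Bijective fun x : Fˣ => x ^ 3 := (powCoprime hcop).bijective
  have h3 : (3 : F) ≠ 0 := by
    have hchar : CharP F p := by
      refine (CharP.charP_iff_prime_eq_zero hp).2 ?_
      have := Nat.cast_card_eq_zero F
      rw [hcard, Nat.cast_pow] at this
      exact pow_eq_zero_iff hr.ne' |>.1 this
    intro h
    have := (CharP.cast_eq_zero_iff F p 3).1 (by exact_mod_cast h)
    have := Nat.le_of_dvd (by norm_num) this
    omega
  have hq : (p : ℂ) ^ r = Fintype.card F := by rw [hcard]; push_cast; rfl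
  have hq1 : (Fintype.card F : ℂ) - 1 ≠ 0 := by
    rw [sub_ne_zero]
    exact_mod_cast (Fintype.one_lt_card (α := F)).ne'
  have key := sum_gaussSum_cube_mul ψ T hT hcube
    (Units.mk0 (-3 * a) (mul_ne_zero (neg_ne_zero.2 h3) ha))
  rw [Units.val_mk0] at key
  rw [← hcard, hq, key, card_mul_card_hessian ψ hψ hcube a, one_div,
    inv_mul_cancel_left₀ hq1]
end
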